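/- arXiv:1104.4110 — 7 statements merged into one kernel-verified Lean document; each statement's English description precedes it below -/
import Mathlib

section
/- Assume the Continuum Hypothesis. Then the set ℝ \ {0} can be covered by countably many subsets of ℝ, each of which is linearly independent over the field ℚ of rational numbers. That is, there exist sets A_n ⊆ ℝ (n ∈ ℕ) with ℝ \ {0} ⊆ ⋃_{n ∈ ℕ} A_n such that each A_n is a ℚ-linearly independent subset of the ℚ-vector space ℝ. -/
/-- A family of nonzero vectors sitting at pairwise distinct levels of an increasing filtration
by subspaces is linearly independent. -/
theorem linearIndependent_of_injective_level {K M ι κ : Type*} [DivisionRing K] [AddCommGroup M]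
    [Module K M] [LinearOrder ι] (V : ι → Submodule K M) (hV : Monotone V) (f : κ → M)
    (hf : ∀ k, f k ≠ 0) (l : κ → ι) (hl : Function.Injective l) (hmem : ∀ k, f k ∈ V (l k))
    (hmin : ∀ k i, f k ∈ V i → l k ≤ i) : LinearIndependent K f := by
  classical
  rw [linearIndependent_iff']
  intro s g hsum
  by_contra! hne
  obtain ⟨k, hks, hgk⟩ := hne
  obtain ⟨a, ha, hamax⟩ := (s.filter (g · ≠ 0)).exists_max_image l
    ⟨k, Finset.mem_filter.2 ⟨hks, hgk⟩⟩
  have hga : g a ≠ 0 := (Finset.mem_filter.1 ha).2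
  have hsum' : ∑ j ∈ s.filter (g · ≠ 0), g j • f j = 0 := by
    rw [← hsum]
    refine Finset.sum_subset (Finset.filter_subset _ _) fun j hj hj' ↦ ?_
    have : g j = 0 := by simpa [hj] using hj'
    simp [this]
  rw [← Finset.add_sum_erase _ _ ha] at hsum'
  rcases ((s.filter (g · ≠ 0)).erase a).eq_empty_or_nonempty with h | h
  · rw [h, Finset.sum_empty, add_zero, smul_eq_zero] at hsum'
    exact hsum'.elim hga (hf a)
  · obtain ⟨b, hb, hbmax⟩ := Finset.exists_max_image _ l h
    have hrest : ∑ j ∈ (s.filter (g · ≠ 0)).erase a, g j • f j ∈ V (l b) :=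
      Submodule.sum_mem _ fun j hj ↦ Submodule.smul_mem _ _ (hV (hbmax j hj) (hmem j))
    have hfa : f a ∈ V (l b) := by
      rw [← Submodule.smul_mem_iff _ hga, eq_neg_of_add_eq_zero_left hsum']
      exact Submodule.neg_mem _ hrest
    have hab : l a = l b := (hmin a _ hfa).antisymm (hamax b (Finset.mem_of_mem_erase hb))
    exact Finset.ne_of_mem_erase hb (hl hab).symm

/-- A vector space exhausted by a well-ordered increasing family of countable subspaces is, apart
from zero, a countable union of linearly independent sets. -/
theorem exists_linearIndependent_cover {K M ι : Type*} [DivisionRing K] [AddCommGroup M]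
    [Module K M] [LinearOrder ι] [WellFoundedLT ι] (V : ι → Submodule K M) (hV : Monotone V)
    (hcount : ∀ i, Countable (V i)) (hcover : ∀ x, ∃ i, x ∈ V i) :
    ∃ A : ℕ → Set M, (Set.univ \ {0} : Set M) ⊆ ⋃ n, A n ∧
      ∀ n, LinearIndependent K ((↑) : A n → M) := by
  have hlevel (x : M) : ∃ i, x ∈ V i ∧ ∀ j, x ∈ V j → i ≤ j :=
    ⟨wellFounded_lt.min {i | x ∈ V i} (hcover x), wellFounded_lt.min_mem _ (hcover x),
      fun _ hj ↦ wellFounded_lt.min_le (s := {i | x ∈ V i}) hj⟩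
  choose l hl hmin using hlevel
  choose c hc using fun i ↦ (hcount i).exists_injective_nat
  refine ⟨fun n ↦ {x | x ≠ 0 ∧ c (l x) ⟨x, hl x⟩ = n}, fun x hx ↦ ?_, fun n ↦ ?_⟩
  · exact Set.mem_iUnion.2 ⟨_, hx.2, rfl⟩
  · refine linearIndependent_of_injective_level V hV _ (fun x ↦ x.2.1) (fun x ↦ l x) ?_
      (fun x ↦ hl x) (fun x ↦ hmin x)
    rintro ⟨x, hx, hxn⟩ ⟨y, hy, hyn⟩ (hxy : l x = l y)
    have key : ∀ i (hxi : x ∈ V i) (hyi : y ∈ V i), c i ⟨x, hxi⟩ = c i ⟨y, hyi⟩ → x = y :=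
      fun i _ _ h ↦ congrArg Subtype.val (hc i h)
    have hcongr : ∀ i (h : l y = i) (hyi : y ∈ V i), c i ⟨y, hyi⟩ = n := by
      rintro _ rfl _
      exact hyn
    exact Subtype.ext (key (l x) (hl x) (hxy ▸ hl y) (hxn.trans (hcongr _ hxy.symm _).symm))

/-- Assuming the Continuum Hypothesis, `ℝ \ {0}` can be covered by countably many
subsets of `ℝ`, each of which is linearly independent over `ℚ`. -/
theorem stmt_0
    (CH : Cardinal.continuum = Cardinal.aleph 1) :
    ∃ A : ℕ → Set ℝ,
      (Set.univ \ {0} : Set ℝ) ⊆ ⋃ n, A n ∧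
      ∀ n, LinearIndependent ℚ ((↑) : A n → ℝ) := by
  have hcard : Cardinal.mk (Cardinal.aleph 1).ord.ToType = Cardinal.mk ℝ := by
    rw [Cardinal.mk_ord_toType, Cardinal.mk_real, ← Cardinal.lift_inj, Cardinal.lift_continuum, CH]
    simp
  obtain ⟨e⟩ := Cardinal.eq.1 hcard
  refine exists_linearIndependent_cover (fun i ↦ Submodule.span ℚ (e '' Set.Iic i))
    (fun i j hij ↦ Submodule.span_mono (Set.image_mono (Set.Iic_subset_Iic.2 hij)))
    (fun i ↦ ?_) (fun x ↦ ⟨e.symm x, Submodule.subset_span ⟨e.symm x, Set.self_mem_Iic, by simp⟩⟩)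
  have hIio : (Set.Iio i).Countable := by
    rw [← Cardinal.le_aleph0_iff_set_countable, ← Cardinal.lt_aleph_one_iff]
    simpa using Cardinal.mk_Iio_lt i (by simp)
  have hIic : (Set.Iic i).Countable := Set.Iio_insert (a := i) ▸ hIio.insert i
  have := hIic.to_subtype
  rw [Set.image_eq_range]
  infer_instance
end

section
/- Assume the negation of the Continuum Hypothesis. Then the set ℝ \ {0} cannot be covered by countably many subsets of ℝ each of which is linearly independent over ℚ: for every countable family of sets A_n ⊆ ℝ (n ∈ ℕ) such that each A_n is ℚ-linearly independent in the ℚ-vector space ℝ, one has ℝ \ {0} ⊄ ⋃_{n ∈ ℕ} A_n. -/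
open Cardinal in
/-- If `ℝ` has more than `ℵ₁` elements, every colouring of `ℝ` by a countable type takes the same
value at four distinct points `x₁ + y₁`, `x₂ + y₁`, `x₁ + y₂`, `x₂ + y₂`. -/
lemma exists_monochromatic_sums {κ : Type} [Countable κ] (h : ℵ₁ < (𝔠 : Cardinal.{0})) (c : ℝ → κ) :
    ∃ x₁ x₂ y₁ y₂ : ℝ, x₁ ≠ x₂ ∧ y₁ ≠ y₂ ∧ x₁ + y₂ ≠ x₂ + y₁ ∧ x₁ + y₁ ≠ x₂ + y₂ ∧
      c (x₂ + y₁) = c (x₁ + y₁) ∧ c (x₁ + y₂) = c (x₁ + y₁) ∧ c (x₂ + y₂) = c (x₁ + y₁) := by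
  obtain ⟨X, hX⟩ := le_mk_iff_exists_set.1 (mk_real ▸ h.le : ℵ₁ ≤ #ℝ)
  have hpair (y : ℝ) : ∃ x₁ x₂ : X, x₁ ≠ x₂ ∧ c (x₁ + y) = c (x₂ + y) := by
    by_contra! hne
    have hinj : Function.Injective fun x : X => c (x + y) := fun a b hab => by
      by_contra hab'
      exact hne a b hab' hab
    have hle : #X ≤ ℵ₀ := mk_le_aleph0_iff.2 hinj.countable
    rw [hX] at hle
    exact hle.not_gt aleph0_lt_aleph_one
  choose f g hfg hc using hpair
  have hcard : #(X × X × κ) = ℵ₁ := by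
    have hκ : #κ ≤ ℵ₁ := (mk_le_aleph0_iff.2 ‹_›).trans aleph0_lt_aleph_one.le
    have : Nonempty κ := ⟨c 0⟩
    have h1 : ℵ₀ ≤ ℵ₁ := aleph0_lt_aleph_one.le
    simp only [mk_prod, lift_id, hX]
    rw [mul_eq_left h1 hκ (mk_ne_zero κ), mul_eq_self h1]
  obtain ⟨⟨a, b, n⟩, hfib⟩ := infinite_pigeonhole_card_lt
    (fun y : ℝ => (f y, g y, c (f y + y))) (by rw [hcard, mk_real]; exact h)
    (aleph0_le_mk ℝ)
  rw [hcard] at hfib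
  have hinf : ((fun y : ℝ => (f y, g y, c (f y + y))) ⁻¹' {(a, b, n)}).Infinite :=
    Set.infinite_coe_iff.1 (infinite_iff.2 (aleph0_lt_aleph_one.trans hfib).le)
  obtain ⟨y₁, hy₁⟩ := hinf.nonempty
  obtain ⟨y₂, hy₂, hne⟩ := hinf.exists_notMem_finset
    {y₁, (b : ℝ) + y₁ - a, (a : ℝ) + y₁ - b}
  simp only [Set.mem_preimage, Set.mem_singleton_iff, Prod.mk.injEq] at hy₁ hy₂
  simp only [Finset.mem_insert, Finset.mem_singleton, not_or] at hne
  obtain ⟨rfl, rfl, rfl⟩ := hy₁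
  obtain ⟨hf, hg, hn⟩ := hy₂
  have hc₂ := hc y₂
  rw [hf] at hn hc₂
  rw [hg] at hc₂
  refine ⟨f y₁, g y₁, y₁, y₂, fun e => hfg y₁ (Subtype.ext e), fun e => hne.1 e.symm,
    fun e => hne.2.1 (by linarith), fun e => hne.2.2 (by linarith), (hc y₁).symm, hn,
    hc₂.symm.trans hn⟩

/-- A linearly independent set contains no element `p = q + r - s` with `q, r, s` other elements
of the set. -/
lemma LinearIndependent.add_sub_ne {R M : Type*} [Ring R] [Nontrivial R] [AddCommGroup M]
    [Module R M] {A : Set M} (hA : LinearIndependent R ((↑) : A → M)) {p q r s : M}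
    (hp : p ∈ A) (hq : q ∈ A) (hr : r ∈ A) (hs : s ∈ A) (hqp : q ≠ p) (hrp : r ≠ p)
    (hsp : s ≠ p) : q + r - s ≠ p := by
  intro e
  have hmem {z : M} (hz : z ∈ A) (hzp : z ≠ p) :
      z ∈ Submodule.span R (((↑) : A → M) '' {x | x ≠ ⟨p, hp⟩}) :=
    Submodule.subset_span ⟨⟨z, hz⟩, fun h => hzp (congrArg Subtype.val h), rfl⟩
  refine hA.notMem_span_image (s := {x | x ≠ ⟨p, hp⟩}) (x := ⟨p, hp⟩) (fun h => h rfl) ?_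
  have := Submodule.sub_mem _ (Submodule.add_mem _ (hmem hq hqp) (hmem hr hrp)) (hmem hs hsp)
  rwa [e] at this

/-- Assuming the negation of the Continuum Hypothesis, `ℝ \ {0}` cannot be covered by
countably many subsets of `ℝ` each of which is linearly independent over `ℚ`. -/
theorem stmt_1
    (nCH : Cardinal.continuum ≠ Cardinal.aleph 1) :
    ∀ A : ℕ → Set ℝ,
      (∀ n, LinearIndependent ℚ ((↑) : A n → ℝ)) →
      ¬ ((Set.univ \ {0} : Set ℝ) ⊆ ⋃ n, A n) := by
  intro A hA hcov
  have hcolour (x : ℝ) : ∃ o : Option ℕ, (o = none → x = 0) ∧ ∀ n, o = some n → x ∈ A n := by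
    by_cases hx : x = 0
    · exact ⟨none, by simp [hx]⟩
    · obtain ⟨n, hn⟩ := Set.mem_iUnion.1 (hcov ⟨trivial, hx⟩)
      exact ⟨some n, by simpa using hn⟩
  choose c hc₀ hc using hcolour
  have nCH₀ : Cardinal.aleph 1 ≠ (Cardinal.continuum : Cardinal.{0}) := fun e =>
    nCH (by simpa using (congrArg Cardinal.lift e).symm)
  obtain ⟨x₁, x₂, y₁, y₂, hx, hy, h₁, h₂, e₁, e₂, e₃⟩ :=
    exists_monochromatic_sums (Cardinal.aleph_one_le_continuum.lt_of_ne nCH₀) c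
  cases hn : c (x₁ + y₁) with
  | none =>
    rw [hn] at e₁
    exact hx (by linarith [hc₀ _ hn, hc₀ _ e₁])
  | some n =>
    rw [hn] at e₁ e₂ e₃
    exact (hA n).add_sub_ne (hc _ n hn) (hc _ n e₁) (hc _ n e₂) (hc _ n e₃)
      (fun e => hx (by linarith)) (fun e => hy (by linarith)) h₂.symm (by ring)
end

section
/- Assume the Continuum Hypothesis. Then every productively Lindelöf regular Hausdorff space is a D-space: if X is a regular Hausdorff topological space such that X × L is Lindelöf for every Lindelöf space L, then for every neighborhood assignment N on X there is a closed discrete subset D ⊆ X with ⋃_{d∈D} N(d) = X. -/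
universe u v

/-- `X` is a D-space: for every neighborhood assignment `N` there is a closed discrete
subset `D` with `⋃ d ∈ D, N d = X`. -/
def IsDSpace (X : Type*) [TopologicalSpace X] : Prop :=
  ∀ N : X → Set X, (∀ x, IsOpen (N x) ∧ x ∈ N x) →
    ∃ D : Set X, IsClosed D ∧ DiscreteTopology D ∧ (⋃ d ∈ D, N d) = Set.univ

open Set Topology

/-- The space `Z` with every point outside `T` declared isolated. -/
def Michael (Z : Type*) (_T : Set Z) : Type _ := Z

instance Michael.topologicalSpace (Z : Type*) [TopologicalSpace Z] (T : Set Z) :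
    TopologicalSpace (Michael Z T) where
  IsOpen O := ∀ z : Z, z ∈ T → z ∈ (show Set Z from O) → (show Set Z from O) ∈ 𝓝 z
  isOpen_univ := fun _ _ _ => Filter.univ_mem
  isOpen_inter := fun _ _ hs ht z hz h => Filter.inter_mem (hs z hz h.1) (ht z hz h.2)
  isOpen_sUnion := fun _ hS z hz ⟨s, hs, h⟩ =>
    Filter.mem_of_superset (hS s hs z hz h) (subset_sUnion_of_mem hs)

namespace Michael

variable {Z : Type*} [TopologicalSpace Z] {T : Set Z}

/-- The identity map onto the original space. -/
def toBase (z : Michael Z T) : Z := z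

/-- The identity map from the original space. -/
def ofBase (z : Z) : Michael Z T := z

theorem isOpen_singleton {z : Z} (hz : z ∉ T) : IsOpen ({ofBase z} : Set (Michael Z T)) := by
  rintro w hw rfl
  exact absurd hw hz

theorem continuous_toBase : Continuous (toBase : Michael Z T → Z) :=
  ⟨fun O hO z _ hz => IsOpen.mem_nhds (X := Z) (s := O) (x := z) hO hz⟩

/-- A set containing `T` is Lindelöf in the Michael topology as soon as `T` is Lindelöf and every
open neighborhood of `T` contains all but countably many of its points. -/
theorem isLindelof_preimage_toBase {P : Set Z} (hT : IsLindelof T) (hTP : T ⊆ P)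
    (hP : ∀ O : Set Z, IsOpen O → T ⊆ O → (P \ O).Countable) :
    IsLindelof (toBase ⁻¹' P : Set (Michael Z T)) := by
  refine isLindelof_of_countable_subcover fun {ι} U hUo hPU => ?_
  have hTU : T ⊆ ⋃ i, interior (ofBase ⁻¹' U i : Set Z) := fun z hz => by
    obtain ⟨i, hi⟩ := mem_iUnion.1 (hPU (hTP hz))
    exact mem_iUnion.2 ⟨i, mem_interior_iff_mem_nhds.2 (hUo i z hz hi)⟩
  obtain ⟨t, ht, hTt⟩ := hT.elim_countable_subcover _ (fun i => isOpen_interior) hTU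
  have hc := hP _ (isOpen_biUnion fun i (_ : i ∈ t) => isOpen_interior) hTt
  have hex : ∀ z : P, ∃ i, ofBase z.1 ∈ U i := fun z => mem_iUnion.1 (hPU z.2)
  choose i hi using hex
  refine ⟨t ∪ i '' (Subtype.val ⁻¹' (P \ ⋃ i ∈ t, interior (ofBase ⁻¹' U i : Set Z))),
    ht.union ((hc.preimage Subtype.val_injective).image _), fun z hz => ?_⟩
  by_cases h : toBase z ∈ ⋃ i ∈ t, interior (ofBase ⁻¹' U i : Set Z)
  · obtain ⟨j, hj, hzj⟩ := mem_iUnion₂.1 h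
    have : toBase z ∈ (ofBase ⁻¹' U j : Set Z) := interior_subset hzj
    exact mem_iUnion₂.2 ⟨j, Or.inl hj, this⟩
  · exact mem_iUnion₂.2 ⟨i ⟨toBase z, hz⟩, Or.inr ⟨⟨toBase z, hz⟩, ⟨hz, h⟩, rfl⟩, hi ⟨toBase z, hz⟩⟩

end Michael

theorem exists_wellOrder_countable_initial {α : Type*} (h : Cardinal.mk α ≤ Cardinal.aleph 1) :
    ∃ r : α → α → Prop, IsWellOrder α r ∧ ∀ a, {b | r b a}.Countable := by
  obtain ⟨r, hr, h1⟩ := Cardinal.exists_ord_eq α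
  refine ⟨r, hr, fun a => ?_⟩
  rw [← Cardinal.le_aleph0_iff_set_countable, ← Cardinal.lt_aleph_one_iff]
  have := Ordinal.typein_lt_type r a
  rw [← h1, Cardinal.lt_ord] at this
  exact lt_of_lt_of_le this h

/-- A compact set of sequences of finite values in `ℕ∞` is bounded by a sequence of naturals. -/
theorem IsCompact.exists_nat_seq_bound {K : Set (ℕ → ℕ∞)} (hK : IsCompact K)
    (hfin : ∀ z ∈ K, ∀ n, z n ≠ ⊤) : ∃ g : ℕ → ℕ, ∀ z ∈ K, ∀ n, z n ≤ g n := by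
  rcases K.eq_empty_or_nonempty with rfl | hne
  · exact ⟨0, by simp⟩
  have hmax : ∀ n, ∃ w ∈ K, ∀ z ∈ K, z n ≤ w n := fun n =>
    hK.exists_isMaxOn hne (continuous_apply n).continuousOn
  choose w hw hmax using hmax
  refine ⟨fun n => (w n n).toNat, fun z hz n => ?_⟩
  rw [ENat.natCast_toNat (hfin _ (hw n) n)]
  exact hmax n z hz

/-- Under CH, for every sequence of countable open covers of a productively Lindelöf space,
countably many functions suffice to bound, at each point, indices of members containing it. -/
theorem exists_countable_bounding_of_prod_lindelof
    (CH : Cardinal.mk (ℕ → ℕ) = Cardinal.aleph 1) {X : Type u} [TopologicalSpace X]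
    (hprod : ∀ (L : Type v) [TopologicalSpace L], LindelofSpace L → LindelofSpace (X × L))
    (U : ℕ → ℕ → Set X) (hUo : ∀ n k, IsOpen (U n k)) (hU : ∀ n x, ∃ k, x ∈ U n k) :
    ∃ S : Set (ℕ → ℕ), S.Countable ∧ ∀ x, ∃ f ∈ S, ∀ n, ∃ k ≤ f n, x ∈ U n k := by
  classical
  by_contra! h
  obtain ⟨r, hr, hrc⟩ := exists_wellOrder_countable_initial CH.le
  have hr' : ∀ f, {g | r g f ∨ g = f}.Countable := fun f =>
    ((hrc f).union (countable_singleton f))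
  choose x hx using fun f => h _ (hr' f)
  let a : (ℕ → ℕ) → ℕ → ℕ := fun f n => Nat.find (hU n (x f))
  have ha : ∀ f n, x f ∈ U n (a f n) := fun f n => Nat.find_spec (hU n (x f))
  have hac : ∀ g : ℕ → ℕ, {f | ∀ n, a f n ≤ g n}.Countable := fun g => by
    refine (hrc g).mono fun f hf => ?_
    by_contra hfg
    have : r g f ∨ g = f := by
      rcases trichotomous_of r f g with h | h | h
      · exact absurd h hfg
      · exact Or.inr h.symm
      · exact Or.inl h
    obtain ⟨n, hn⟩ := hx f g this
    exact hn _ (hf n) (ha f n)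
  let p : (ℕ → ℕ) → ℕ → ℕ∞ := fun f n => (a f n : ℕ∞)
  let T : Set (ℕ → ℕ∞) := {z | ∃ n, z n = ⊤}
  have hpT : ∀ f, p f ∉ T := fun f ⟨n, hn⟩ => ENat.natCast_ne_top _ hn
  have hlind : IsLindelof (Michael.toBase ⁻¹' (T ∪ range p) : Set (Michael (ℕ → ℕ∞) T)) := by
    refine Michael.isLindelof_preimage_toBase (HereditarilyLindelofSpace.isLindelof T)
      subset_union_left fun O hO hTO => ?_
    obtain ⟨g, hg⟩ := hO.isClosed_compl.isCompact.exists_nat_seq_bound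
      fun z hz n hn => hz (hTO ⟨n, hn⟩)
    refine ((hac g).image p).mono ?_
    rintro z ⟨hz | ⟨f, rfl⟩, hzO⟩
    · exact absurd (hTO hz) hzO
    · exact ⟨f, fun n => Nat.cast_le.1 (hg _ hzO n), rfl⟩
  have := isLindelof_iff_lindelofSpace.1 hlind
  let L := ULift.{v} (Michael.toBase ⁻¹' (T ∪ range p) : Set (Michael (ℕ → ℕ∞) T))
  have hL : LindelofSpace L :=
    LindelofSpace.of_continuous_surjective continuous_uliftUp ULift.up_surjective
  have hXL := hprod L hL
  let q : L → Michael (ℕ → ℕ∞) T := fun l => l.down.1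
  have hq : Continuous q := continuous_subtype_val.comp continuous_uliftDown
  let R : Set (X × L) := {y | ∀ n j, y.1 ∈ U n j → (q y.2).toBase n ≤ j}
  have hR : IsClosed R := by
    have : R = ⋂ (n : ℕ) (j : ℕ), {y : X × L | y.1 ∈ U n j → (q y.2).toBase n ≤ j} := by
      ext y; simp [R]
    rw [this]
    refine isClosed_iInter fun n => isClosed_iInter fun j => ?_
    refine isClosed_imp ((hUo n j).preimage continuous_fst) ?_
    exact isClosed_le ((continuous_apply n).comp
      (Michael.continuous_toBase.comp (hq.comp continuous_snd))) continuous_const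
  obtain ⟨t, ht, hRt⟩ := hR.isLindelof.elim_countable_subcover
    (fun f => {y : X × L | q y.2 = Michael.ofBase (p f)})
    (fun f => (Michael.isOpen_singleton (hpT f)).preimage (hq.comp continuous_snd))
    (by
      rintro ⟨y, l⟩ hy
      rcases l.down.2 with ⟨n, hn⟩ | ⟨f, hf⟩
      · obtain ⟨k, hk⟩ := hU n y
        have := hy n k hk
        exact absurd (top_le_iff.1 (hn.symm.le.trans this)) (ENat.natCast_ne_top k)
      · exact mem_iUnion.2 ⟨f, hf.symm⟩)
  have huniv : (univ : Set (ℕ → ℕ)) ⊆ ⋃ g ∈ t, {f | ∀ n, a f n ≤ a g n} := fun f _ => by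
    have hmem : ((x f, ⟨⟨Michael.ofBase (p f), Or.inr ⟨f, rfl⟩⟩⟩) : X × L) ∈ R := fun n j hj =>
      Nat.cast_le.2 (Nat.find_min' (hU n (x f)) hj)
    obtain ⟨g, hg, hfg⟩ := mem_iUnion₂.1 (hRt hmem)
    refine mem_iUnion₂.2 ⟨g, hg, fun n => ?_⟩
    have : p f n = p g n := congrFun hfg n
    exact (Nat.cast_injective this).le
  have hcount := (ht.biUnion fun g _ => hac (a g)).mono huniv
  rw [countable_univ_iff, ← Cardinal.mk_le_aleph0_iff, CH] at hcount
  exact absurd hcount (not_le.2 Cardinal.aleph0_lt_aleph_one)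

/-- Every set-valued map with countable values admits a countable set closed under the map on
finite subsets. -/
theorem exists_countable_closed_finite {X : Type*} (g : Set X → Set X)
    (hg : ∀ F, (g F).Countable) :
    ∃ C : Set X, C.Countable ∧ ∀ F ⊆ C, F.Finite → g F ⊆ C := by
  let s : ℕ → Set X := fun n => n.rec ∅ fun _ s => s ∪ ⋃ F ∈ {F | F.Finite ∧ F ⊆ s}, g F
  have hsucc : ∀ n, s (n + 1) = s n ∪ ⋃ F ∈ {F | F.Finite ∧ F ⊆ s n}, g F := fun n => rfl
  have hmono : Monotone s := monotone_nat_of_le_succ fun n => by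
    rw [hsucc]; exact subset_union_left
  have hs : ∀ n, (s n).Countable := fun n => by
    induction n with
    | zero => exact countable_empty
    | succ n ih =>
      rw [hsucc]
      exact ih.union ((countable_ofPred_finite_subset ih).biUnion fun F _ => hg F)
  refine ⟨⋃ n, s n, countable_iUnion hs, fun F hF hfin => ?_⟩
  obtain ⟨n, hn⟩ := hmono.directed_le.exists_mem_subset_of_finset_subset_biUnion
    (s := hfin.toFinset) (by simpa using hF)
  rw [hfin.coe_toFinset] at hn
  refine subset_trans ?_ (subset_iUnion s (n + 1))
  rw [hsucc]
  exact (subset_biUnion_of_mem (u := g) (show F ∈ {F | F.Finite ∧ F ⊆ s n} from ⟨hfin, hn⟩)).trans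
    subset_union_right

/-- A set which meets some neighborhood of every point of a T₁ space in a finite set is closed
and discrete. -/
theorem isClosed_and_discreteTopology_of_finite_inter {X : Type*} [TopologicalSpace X] [T1Space X]
    {D : Set X} (h : ∀ x, ∃ V ∈ 𝓝 x, (V ∩ D).Finite) : IsClosed D ∧ DiscreteTopology D := by
  have : IsClosed D ∧ IsDiscrete D := isClosed_and_discrete_iff.2 fun x => by
    obtain ⟨V, hV, hfin⟩ := h x
    rw [Filter.disjoint_principal_right]
    have hx : ((V ∩ D) \ {x})ᶜ ∈ 𝓝 x :=
      (hfin.sdiff (t := {x})).isClosed.isOpen_compl.mem_nhds fun hx => hx.2 rfl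
    filter_upwards [nhdsWithin_le_nhds hV, nhdsWithin_le_nhds hx, self_mem_nhdsWithin]
      with y hyV hy hyx hyD
    exact hy ⟨⟨hyV, hyD⟩, hyx⟩
  exact ⟨this.1, this.2.to_subtype⟩

theorem mk_nat_fun_eq_aleph_one (CH : Cardinal.continuum.{w} = Cardinal.aleph 1) :
    Cardinal.mk (ℕ → ℕ) = Cardinal.aleph 1 := by
  have h : Cardinal.mk (ℕ → ℕ) = Cardinal.continuum := by simp
  rw [h, ← Cardinal.lift_inj.{0, w}]
  simpa using CH

/-- CH implies that every productively Lindelöf regular Hausdorff space is a D-space. -/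
theorem stmt_8
    (CH : Cardinal.continuum = Cardinal.aleph 1)
    (X : Type u) [TopologicalSpace X] [T3Space X]
    (hprod : ∀ (L : Type v) [TopologicalSpace L], LindelofSpace L → LindelofSpace (X × L)) :
    IsDSpace X := by
  classical
  intro N hN
  rcases isEmpty_or_nonempty X with hX | hX
  · exact ⟨∅, isClosed_empty, inferInstance, Subsingleton.elim _ _⟩
  have : LindelofSpace X := by
    have := hprod PUnit inferInstance
    exact LindelofSpace.of_continuous_surjective continuous_fst
      (Prod.fst_surjective (α := X) (β := PUnit.{v + 1}))
  have hg : ∀ F : Set X, ∃ G : Set X, G.Countable ∧ G ⊆ (⋃ y ∈ F, N y)ᶜ ∧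
      (⋃ y ∈ F, N y)ᶜ ⊆ ⋃ y ∈ G, N y := fun F => by
    have hcl : IsClosed (⋃ y ∈ F, N y)ᶜ := (isOpen_biUnion fun y _ => (hN y).1).isClosed_compl
    obtain ⟨t, ht, hsub, hcov⟩ := hcl.isLindelof.elim_nhds_subcover N
      fun y _ => (hN y).1.mem_nhds (hN y).2
    exact ⟨t, ht, hsub, hcov⟩
  choose g hgc hgs hgcov using hg
  obtain ⟨C, hC, hCg⟩ := exists_countable_closed_finite g hgc
  have hCne : C.Nonempty := by
    obtain ⟨y⟩ := hX
    obtain ⟨z, hz, -⟩ := mem_iUnion₂.1 (hgcov ∅ (show y ∈ _ by simp))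
    exact ⟨z, hCg ∅ (empty_subset _) finite_empty hz⟩
  obtain ⟨c, rfl⟩ := hC.exists_eq_range hCne
  let W : Finset ℕ → Set X := fun F => ⋃ j ∈ F, N (c j)
  have hWo : ∀ F, IsOpen (W F) := fun F => isOpen_biUnion fun j _ => (hN _).1
  have hWcov : ∀ F x, x ∉ W F → ∃ k, c k ∉ W F ∧ x ∈ N (c k) := fun F x hx => by
    have hW : W F = ⋃ y ∈ c '' F, N y := by simp [W]
    rw [hW] at hx ⊢
    obtain ⟨y, hy, hxy⟩ := mem_iUnion₂.1 (hgcov _ hx)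
    obtain ⟨k, rfl⟩ := hCg _ (image_subset_range _ _) (F.finite_toSet.image c) hy
    exact ⟨k, hgs _ hy, hxy⟩
  let e := Denumerable.eqv (Finset ℕ)
  obtain ⟨S, hS, hSX⟩ := exists_countable_bounding_of_prod_lindelof (mk_nat_fun_eq_aleph_one CH)
    hprod (fun n k => W (e.symm n) ∪ {x | c k ∉ W (e.symm n) ∧ x ∈ N (c k)})
    (fun n k => (hWo _).union (isOpen_const.inter (hN _).1))
    (fun n x => by
      by_cases hx : x ∈ W (e.symm n)
      · exact ⟨0, Or.inl hx⟩
      · obtain ⟨k, hk⟩ := hWcov _ x hx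
        exact ⟨k, Or.inr hk⟩)
  have hSne : S.Nonempty := by
    obtain ⟨y⟩ := hX
    obtain ⟨f, hf, -⟩ := hSX y
    exact ⟨f, hf⟩
  obtain ⟨s, rfl⟩ := hS.exists_eq_range hSne
  let F : ℕ → Finset ℕ := fun m =>
    m.rec ∅ fun m G => G ∪ (Finset.range (s m (e G) + 1)).filter fun j => c j ∉ W G
  have hF : ∀ m, F (m + 1) =
    F m ∪ (Finset.range (s m (e (F m)) + 1)).filter fun j => c j ∉ W (F m) := fun m => rfl
  have hFmono : Monotone F := monotone_nat_of_le_succ fun m => by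
    rw [hF]; exact Finset.subset_union_left
  have hnew : ∀ m m' j, j ∈ F m' → j ∈ F m ∨ c j ∉ W (F m) := fun m m' j hj => by
    induction m' with
    | zero => simp [F] at hj
    | succ k ih =>
      rw [hF, Finset.mem_union, Finset.mem_filter] at hj
      rcases hj with hj | ⟨hj, hcj⟩
      · exact ih hj
      rcases le_or_gt m k with hmk | hmk
      · exact Or.inr fun h => hcj (biUnion_subset_biUnion_left (hFmono hmk) h)
      · refine Or.inl (hFmono hmk ?_)
        rw [hF, Finset.mem_union, Finset.mem_filter]
        exact Or.inr ⟨hj, hcj⟩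
  have hcov : ∀ x, ∃ m, x ∈ W (F m) := fun x => by
    obtain ⟨-, ⟨m, rfl⟩, hm⟩ := hSX x
    obtain ⟨k, hk, hxk⟩ := hm (e (F m))
    rw [e.symm_apply_apply] at hxk
    refine ⟨m + 1, ?_⟩
    rcases hxk with hxk | ⟨hck, hxk⟩
    · exact biUnion_subset_biUnion_left (hFmono m.le_succ) hxk
    · refine mem_iUnion₂.2 ⟨k, ?_, hxk⟩
      rw [hF, Finset.mem_union, Finset.mem_filter, Finset.mem_range]
      exact Or.inr ⟨by omega, hck⟩
  let D : Set X := ⋃ m, c '' {j | j ∈ F m}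
  obtain ⟨hcl, hdisc⟩ := isClosed_and_discreteTopology_of_finite_inter (D := D) fun x => by
      obtain ⟨m, hm⟩ := hcov x
      refine ⟨W (F m), (hWo _).mem_nhds hm, ((F m).finite_toSet.image c).subset ?_⟩
      rintro _ ⟨hy, hyD⟩
      obtain ⟨m', j, hj, rfl⟩ := mem_iUnion.1 hyD
      exact ⟨j, (hnew m m' j hj).resolve_right (not_not.2 hy), rfl⟩
  refine ⟨D, hcl, hdisc, eq_univ_of_forall fun x => ?_⟩
  obtain ⟨m, hm⟩ := hcov x
  obtain ⟨j, hj, hxj⟩ := mem_iUnion₂.1 hm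
  exact mem_iUnion₂.2 ⟨c j, mem_iUnion.2 ⟨m, j, hj, rfl⟩, hxj⟩
end

section
/- If there exists a Michael space, then every productively Lindelöf space has the Menger property: if there is a Lindelöf space M such that the product of M with the space of irrational numbers (the subspace {x ∈ ℝ : x is irrational} of ℝ) is not Lindelöf, then every topological space X such that X × L is Lindelöf for every Lindelöf space L is Menger. -/
universe u v

/-- `X` is Menger: from every sequence of open covers one can pick finite subfamilies
whose union is a cover. -/
def IsMenger (X : Type*) [TopologicalSpace X] : Prop :=
  ∀ 𝒰 : ℕ → Set (Set X),
    (∀ n, (∀ U ∈ 𝒰 n, IsOpen U) ∧ ⋃₀ 𝒰 n = Set.univ) →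
    ∃ 𝒱 : ℕ → Set (Set X), (∀ n, 𝒱 n ⊆ 𝒰 n ∧ (𝒱 n).Finite) ∧
      (⋃ n, ⋃₀ 𝒱 n) = Set.univ

open Filter Topology

/-- A space admitting a proper map into a Lindelöf space is Lindelöf. -/
theorem IsProperMap.lindelofSpace {Y Z : Type*} [TopologicalSpace Y] [TopologicalSpace Z]
    [LindelofSpace Y] {p : Z → Y} (hp : IsProperMap p) : LindelofSpace Z := by
  refine ⟨fun F _ _ _ => ?_⟩
  obtain ⟨y, hy⟩ := cluster_point_of_Lindelof (F.map p)
  obtain ⟨z, -, hz⟩ := hp.clusterPt_of_mapClusterPt hy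
  exact ⟨z, trivial, hz⟩

/-- If each `U n` enumerates an open cover of `X`, the projection to `X` of the closed relation
`∀ n, ∀ i ≤ g n, x ∉ U n i` on `X × (ℕ → ℕ)` is proper. -/
theorem isProperMap_fst_of_avoiding {X : Type*} [TopologicalSpace X] (U : ℕ → ℕ → Set X)
    (hU : ∀ n i, IsOpen (U n i)) (hcover : ∀ n, ⋃ i, U n i = Set.univ) :
    IsProperMap (fun z : {z : X × (ℕ → ℕ) // ∀ n, ∀ i ≤ z.2 n, z.1 ∉ U n i} => z.1.1) := by
  rw [isProperMap_iff_ultrafilter]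
  refine ⟨by fun_prop, fun F x hx => ?_⟩
  have hbound (n : ℕ) : ∃ k, ∀ᶠ z in F.toFilter, z.1.2 n < k := by
    obtain ⟨k, hk⟩ := Set.mem_iUnion.1 ((hcover n).symm ▸ Set.mem_univ x)
    refine ⟨k, (hx.eventually ((hU n k).mem_nhds hk)).mono fun z hz => ?_⟩
    by_contra! h
    exact z.2 n k h hz
  have hlim (n : ℕ) : ∃ m, ∀ᶠ z in F.toFilter, z.1.2 n = m := by
    obtain ⟨k, hk⟩ := hbound n
    have : ∀ᶠ z in F.toFilter, ∃ m ∈ Set.Iio k, z.1.2 n = m := hk.mono fun z hz => ⟨_, hz, rfl⟩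
    obtain ⟨m, -, hm⟩ := (Ultrafilter.eventually_exists_mem_iff (Set.finite_Iio k)).1 this
    exact ⟨m, hm⟩
  choose g hg using hlim
  have hmem : ∀ n, ∀ i ≤ g n, x ∉ U n i := by
    intro n i hi hxi
    obtain ⟨z, hz, hzg⟩ := ((hx.eventually ((hU n i).mem_nhds hxi)).and (hg n)).exists
    exact z.2 n i (hi.trans_eq hzg.symm) hz
  refine ⟨⟨(x, g), hmem⟩, rfl, ?_⟩
  rw [nhds_subtype_eq_comap, ← tendsto_iff_comap, nhds_prod_eq]
  refine hx.prodMk (tendsto_pi_nhds.2 fun n => ?_)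
  exact tendsto_const_nhds.congr' ((hg n).mono fun z hz => hz.symm)

/-- If `X` is Lindelöf but not Menger and `X × L` is Lindelöf, then so is `(ℕ → ℕ) × L`: it is a
continuous image of a space that maps properly to `X × L`. -/
theorem lindelofSpace_baire_prod_of_not_isMenger {X L : Type*} [TopologicalSpace X]
    [TopologicalSpace L] [LindelofSpace X] [LindelofSpace (X × L)] (hX : ¬ IsMenger X) :
    LindelofSpace ((ℕ → ℕ) × L) := by
  unfold IsMenger at hX
  push Not at hX
  obtain ⟨𝒰, h𝒰, hbad⟩ := hX
  have hne : Nonempty X := by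
    by_contra h
    rw [not_nonempty_iff] at h
    exact hbad (fun _ => ∅) (fun n => ⟨Set.empty_subset _, Set.finite_empty⟩)
      (Subsingleton.elim _ _)
  have hcountable (n : ℕ) : ∃ U : ℕ → Set X, (∀ i, U i ∈ 𝒰 n) ∧ ⋃ i, U i = Set.univ := by
    obtain ⟨x₀⟩ := hne
    obtain ⟨V, hV, -⟩ := Set.mem_sUnion.1 ((h𝒰 n).2.symm ▸ Set.mem_univ x₀)
    have : Nonempty (𝒰 n) := ⟨⟨V, hV⟩⟩
    obtain ⟨f, hf⟩ := (isLindelof_univ (X := X)).indexed_countable_subcover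
      (fun U : 𝒰 n => (U : Set X)) (fun U => (h𝒰 n).1 U U.2)
      (by rw [← Set.sUnion_eq_iUnion, (h𝒰 n).2])
    exact ⟨fun i => f i, fun i => (f i).2, Set.univ_subset_iff.1 hf⟩
  choose U hU hcover using hcountable
  have hp := (isProperMap_fst_of_avoiding U (fun n i => (h𝒰 n).1 _ (hU n i)) hcover).prodMap
    (isProperMap_id (X := L))
  have := hp.lindelofSpace
  refine LindelofSpace.of_continuous_surjective
    (f := Prod.map (fun z : {z : X × (ℕ → ℕ) // ∀ n, ∀ i ≤ z.2 n, z.1 ∉ U n i} => z.1.2)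
      (id : L → L)) (by fun_prop) (Function.Surjective.prodMap (fun g => ?_) Function.surjective_id)
  have := hbad (fun n => U n '' Set.Iic (g n))
    (fun n => ⟨by rintro _ ⟨i, -, rfl⟩; exact hU n i, (Set.finite_Iic _).image _⟩)
  obtain ⟨x, hx⟩ := (Set.ne_univ_iff_exists_notMem _).1 this
  refine ⟨⟨(x, g), fun n i hi hxi => hx ?_⟩, rfl⟩
  exact Set.mem_iUnion.2 ⟨n, U n i, ⟨i, hi, rfl⟩, hxi⟩

/-- The irrationals are a continuous image of the Baire space. -/
theorem exists_continuous_surjective_irrational :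
    ∃ f : (ℕ → ℕ) → {x : ℝ // Irrational x}, Continuous f ∧ Function.Surjective f := by
  have hmeas : MeasurableSet {x : ℝ | Irrational x} := (Set.countable_range _).measurableSet.compl
  have hanalytic := hmeas.analyticSet
  rw [MeasureTheory.AnalyticSet] at hanalytic
  rcases hanalytic with h | ⟨f, hf, hrange⟩
  · exact absurd (h ▸ irrational_sqrt_two : √2 ∈ (∅ : Set ℝ)) (Set.notMem_empty _)
  · have hmem (a : ℕ → ℕ) : Irrational (f a) := hrange.subset ⟨a, rfl⟩
    refine ⟨fun a => ⟨f a, hmem a⟩, hf.subtype_mk _, fun x => ?_⟩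
    obtain ⟨a, ha⟩ := hrange.superset x.2
    exact ⟨a, Subtype.ext ha⟩

/-- If there exists a Michael space (a Lindelöf space whose product with the irrationals
is not Lindelöf), then every productively Lindelöf space is Menger. -/
theorem stmt_10
    (hMichael : ∃ (M : Type) (_ : TopologicalSpace M), LindelofSpace M ∧
      ¬ LindelofSpace (M × {x : ℝ // Irrational x}))
    (X : Type u) [TopologicalSpace X]
    (hprod : ∀ (L : Type v) [TopologicalSpace L], LindelofSpace L → LindelofSpace (X × L)) :
    IsMenger X := by
  obtain ⟨M, _, hM, hMirr⟩ := hMichael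
  by_contra hX
  have hup : LindelofSpace (ULift.{v} M) :=
    LindelofSpace.of_continuous_surjective continuous_uliftUp ULift.up_surjective
  have := hprod PUnit inferInstance
  have := hprod (ULift.{v} M) hup
  have : LindelofSpace X := LindelofSpace.of_continuous_surjective
    (f := (Prod.fst : X × PUnit.{v + 1} → X)) continuous_fst Prod.fst_surjective
  have := lindelofSpace_baire_prod_of_not_isMenger (L := ULift.{v} M) hX
  obtain ⟨f, hf, hfs⟩ := exists_continuous_surjective_irrational
  exact hMirr <| LindelofSpace.of_continuous_surjective
    (f := fun z : (ℕ → ℕ) × ULift.{v} M => (z.2.down, f z.1))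
    ((continuous_uliftDown.comp continuous_snd).prodMk (hf.comp continuous_fst))
    fun ⟨m, x⟩ => (hfs x).elim fun a ha => ⟨(a, ⟨m⟩), Prod.ext rfl ha⟩
end

section
/- Assume 𝔟 = 𝔡, where 𝔟 is the least cardinality of a family of functions ℕ → ℕ which is unbounded with respect to eventual domination and 𝔡 is the least cardinality of a family of functions ℕ → ℕ which is dominating with respect to eventual domination. Then the class of M-separable spaces is not closed under finite products: there exist completely regular Hausdorff M-separable spaces X and Y such that the product X × Y is not M-separable. -/
open Filter

/-- The bounding number `𝔟`: least cardinality of a family of functions `ℕ → ℕ` that is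
unbounded with respect to eventual domination. -/
noncomputable def boundingNumber : Cardinal :=
  sInf {c : Cardinal | ∃ F : Set (ℕ → ℕ), Cardinal.mk F = c ∧
    ¬ ∃ g : ℕ → ℕ, ∀ f ∈ F, ∀ᶠ n in atTop, f n ≤ g n}

/-- The dominating number `𝔡`: least cardinality of a family of functions `ℕ → ℕ` that is
dominating with respect to eventual domination. -/
noncomputable def dominatingNumber : Cardinal :=
  sInf {c : Cardinal | ∃ F : Set (ℕ → ℕ), Cardinal.mk F = c ∧
    ∀ h : ℕ → ℕ, ∃ g ∈ F, ∀ᶠ n in atTop, h n ≤ g n}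

/-- `X` is M-separable (selectively separable): for every sequence of dense sets one can
select finite subsets whose union is dense. -/
def MSeparable (X : Type*) [TopologicalSpace X] : Prop :=
  ∀ D : ℕ → Set X, (∀ n, Dense (D n)) →
    ∃ F : ℕ → Set X, (∀ n, F n ⊆ D n ∧ (F n).Finite) ∧ Dense (⋃ n, F n)

theorem exists_eventual_bound_of_nat (F : ℕ → ℕ → ℕ) :
    ∃ g : ℕ → ℕ, ∀ k, ∀ᶠ n in atTop, F k n ≤ g n := by
  refine ⟨fun n => ∑ k ∈ Finset.range (n + 1), F k n, fun k => ?_⟩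
  filter_upwards [eventually_ge_atTop k] with n hn
  exact Finset.single_le_sum (f := fun k => F k n) (fun _ _ => Nat.zero_le _)
    (Finset.mem_range.2 (by omega))

theorem exists_eventual_bound {J : Type} (hJ : Cardinal.mk J < boundingNumber)
    (F : J → ℕ → ℕ) : ∃ g : ℕ → ℕ, ∀ j, ∀ᶠ n in atTop, F j n ≤ g n := by
  have h := notMem_of_lt_csInf (Cardinal.mk_range_le.trans_lt hJ : Cardinal.mk (Set.range F) < _)
    (OrderBot.bddBelow _)
  by_contra hcon
  exact h ⟨_, rfl, fun ⟨g, hg⟩ => hcon ⟨g, fun j => hg _ ⟨j, rfl⟩⟩⟩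

theorem aleph0_lt_boundingNumber : Cardinal.aleph0 < boundingNumber := by
  have hne : {c : Cardinal | ∃ F : Set (ℕ → ℕ), Cardinal.mk F = c ∧
      ¬ ∃ g : ℕ → ℕ, ∀ f ∈ F, ∀ᶠ n in atTop, f n ≤ g n}.Nonempty := by
    refine ⟨_, Set.univ, rfl, ?_⟩
    rintro ⟨g, hg⟩
    obtain ⟨n, hn⟩ := (hg (fun n => g n + 1) trivial).exists
    omega
  obtain ⟨F, hF, hunb⟩ := csInf_mem hne
  by_contra! hle
  have hc : F.Countable := by
    rw [← Set.countable_coe_iff, ← Cardinal.mk_le_aleph0_iff, hF]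
    exact hle
  refine hunb ?_
  rcases F.eq_empty_or_nonempty with rfl | hn
  · exact ⟨0, by simp⟩
  · obtain ⟨f, rfl⟩ := hc.exists_eq_range hn
    obtain ⟨g, hg⟩ := exists_eventual_bound_of_nat f
    exact ⟨g, by rintro _ ⟨k, rfl⟩; exact hg k⟩

theorem mk_finset_lt_boundingNumber {J : Type} (hJ : Cardinal.mk J < boundingNumber) :
    Cardinal.mk (Finset J) < boundingNumber := by
  cases finite_or_infinite J
  · exact (Cardinal.lt_aleph0_of_finite _).trans aleph0_lt_boundingNumber
  · rwa [Cardinal.mk_finset_of_infinite]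

theorem exists_eventual_bound_finset_Iio {ι : Type} [LinearOrder ι] {a : ι}
    (ha : Cardinal.mk (Set.Iio a) < boundingNumber) (T : Finset ι → ℕ → ℕ) :
    ∃ g : ℕ → ℕ, ∀ p : Finset ι, (∀ b ∈ p, b < a) → ∀ᶠ n in atTop, T p n ≤ g n := by
  obtain ⟨g, hg⟩ := exists_eventual_bound (mk_finset_lt_boundingNumber ha)
    (fun p => T (p.map (Function.Embedding.subtype _)))
  refine ⟨g, fun p hp => ?_⟩
  have := hg (p.subtype (· ∈ Set.Iio a))
  rwa [Finset.subtype_map_of_mem (p := (· ∈ Set.Iio a)) hp] at this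

/-- A family `g` along a well-order with small initial segments in which every `g a` lies above
`d a` and eventually above all the functions computed by `T` from finitely many earlier members. -/
theorem exists_recursive_bound {ι : Type} [LinearOrder ι] [WellFoundedLT ι]
    (hι : ∀ a : ι, Cardinal.mk (Set.Iio a) < boundingNumber)
    (T : Finset ι → (ι → ℕ → ℕ) → ℕ → ℕ)
    (hT : ∀ p g g', (∀ b ∈ p, g b = g' b) → T p g = T p g') (d : ι → ℕ → ℕ) :
    ∃ g : ι → ℕ → ℕ, ∀ a, (∀ n, d a n ≤ g a n) ∧
      ∀ p : Finset ι, (∀ b ∈ p, b < a) → ∀ᶠ n in atTop, T p g n ≤ g a n := by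
  have hstep : ∀ (a : ι) (G : ι → ℕ → ℕ), ∃ k : ℕ → ℕ, (∀ n, d a n ≤ k n) ∧
      ∀ p : Finset ι, (∀ b ∈ p, b < a) → ∀ᶠ n in atTop, T p G n ≤ k n := fun a G => by
    obtain ⟨k, hk⟩ := exists_eventual_bound_finset_Iio (hι a) (fun p => T p G)
    refine ⟨fun n => max (d a n) (k n), fun n => le_max_left _ _, fun p hp => ?_⟩
    filter_upwards [hk p hp] with n hn
    exact hn.trans (le_max_right _ _)
  choose s hs hs' using hstep
  let E : ∀ a : ι, (∀ b, b < a → ℕ → ℕ) → ι → ℕ → ℕ :=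
    fun a G b => if hb : b < a then G b hb else 0
  let g : ι → ℕ → ℕ := (wellFounded_lt (α := ι)).fix fun a G => s a (E a G)
  have hg : ∀ a, g a = s a (E a fun b _ => g b) := fun a =>
    (wellFounded_lt (α := ι)).fix_eq _ a
  refine ⟨g, fun a => ⟨fun n => ?_, fun p hp => ?_⟩⟩
  · rw [hg]
    exact hs _ _ _
  · have h := hs' a (E a fun b _ => g b) p hp
    rw [← hg, hT p _ g fun b hb => by simp [E, hp b hb]] at h
    exact h

/-- Endpoints of an interval partition of `ℕ` such that `[n, g n)` meets at most two consecutive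
intervals. -/
def endpoint (g : ℕ → ℕ) : ℕ → ℕ
  | 0 => 0
  | j + 1 => endpoint g j + 1 + ∑ k ∈ Finset.range (endpoint g j + 1), g k

theorem endpoint_strictMono (g : ℕ → ℕ) : StrictMono (endpoint g) :=
  strictMono_nat_of_lt_succ fun j => by simp only [endpoint]; omega

theorem apply_lt_endpoint_succ (g : ℕ → ℕ) {n j : ℕ} (h : n ≤ endpoint g j) :
    g n < endpoint g (j + 1) := by
  have := Finset.single_le_sum (f := g) (fun _ _ => Nat.zero_le _)
    (Finset.mem_range.2 (Order.lt_add_one_iff.2 h))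
  simp only [endpoint]
  omega

theorem exists_endpoint_le_lt (g : ℕ → ℕ) (k : ℕ) :
    ∃ j, endpoint g j ≤ k ∧ k < endpoint g (j + 1) := by
  have h : ∃ j, k < endpoint g (j + 1) :=
    ⟨k, (endpoint_strictMono g).le_apply.trans_lt (endpoint_strictMono g k.lt_succ_self)⟩
  refine ⟨Nat.find h, ?_, Nat.find_spec h⟩
  rcases hj : Nat.find h with _ | j
  · simp [endpoint]
  · exact not_lt.1 (Nat.find_min h (m := j) (by omega))

/-- The union of the intervals with index congruent to `r` modulo `4`. -/
def window (r : ℕ) (g : ℕ → ℕ) : Set ℕ :=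
  {k | ∃ j, endpoint g (4 * j + r) ≤ k ∧ k < endpoint g (4 * j + r + 1)}

/-- The union of the intervals with index congruent to `2` or `3` modulo `4`. -/
def upperSet (g : ℕ → ℕ) : Set ℕ :=
  {k | ∃ j, endpoint g (4 * j + 2) ≤ k ∧ k < endpoint g (4 * j + 4)}

/-- The union of the intervals with index congruent to `0` or `1` modulo `4`, without the left
endpoints of those with index divisible by `4`. -/
def lowerSet (g : ℕ → ℕ) : Set ℕ :=
  {k | ∃ j, endpoint g (4 * j) < k ∧ k < endpoint g (4 * j + 2)}

/-- The least element of `S` that is at least `n`. -/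
noncomputable def nextElement (S : Set ℕ) (n : ℕ) : ℕ := sInf {k | k ∈ S ∧ n ≤ k}

theorem nextElement_spec {S : Set ℕ} (hS : S.Infinite) (n : ℕ) :
    nextElement S n ∈ S ∧ n ≤ nextElement S n :=
  Nat.sInf_mem (s := {k | k ∈ S ∧ n ≤ k}) <| by
    obtain ⟨k, hk, hn⟩ := hS.exists_gt n
    exact ⟨k, hk, hn.le⟩

theorem inter_window_infinite {S : Set ℕ} (hS : S.Infinite) {g : ℕ → ℕ}
    (hg : ∀ᶠ n in atTop, nextElement S n ≤ g n) (r : ℕ) : (S ∩ window r g).Infinite := by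
  obtain ⟨N, hN⟩ := eventually_atTop.1 hg
  rw [Set.infinite_iff_exists_gt]
  intro m
  set j := max N (m + 1)
  have hj : 4 * j + r ≤ endpoint g (4 * j + r) := (endpoint_strictMono g).le_apply
  obtain ⟨h1, h2⟩ := nextElement_spec hS (endpoint g (4 * j + r))
  refine ⟨_, ⟨h1, j, h2, ?_⟩, by omega⟩
  exact (hN _ (by omega)).trans_lt (apply_lt_endpoint_succ g le_rfl)

theorem notMem_upperSet {g : ℕ → ℕ} {j k : ℕ} (h1 : endpoint g (4 * j) ≤ k)
    (h2 : k < endpoint g (4 * j + 2)) : k ∉ upperSet g := by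
  rintro ⟨l, h3, h4⟩
  have h5 := (endpoint_strictMono g).lt_iff_lt.1 (h1.trans_lt h4)
  have h6 := (endpoint_strictMono g).lt_iff_lt.1 (h3.trans_lt h2)
  omega

theorem notMem_lowerSet {g : ℕ → ℕ} {j k : ℕ} (h1 : endpoint g (4 * j + 2) ≤ k)
    (h2 : k < endpoint g (4 * j + 4)) : k ∉ lowerSet g := by
  rintro ⟨l, h3, h4⟩
  have h5 := (endpoint_strictMono g).lt_iff_lt.1 (h1.trans_lt h4)
  have h6 := (endpoint_strictMono g).lt_iff_lt.1 (h3.trans h2)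
  omega

theorem endpoint_notMem_lowerSet (g : ℕ → ℕ) (j : ℕ) : endpoint g (4 * j) ∉ lowerSet g := by
  rintro ⟨l, h3, h4⟩
  have h5 := (endpoint_strictMono g).lt_iff_lt.1 h4
  have h6 := (endpoint_strictMono g).lt_iff_lt.1 h3
  omega

theorem window_zero_gap {f g : ℕ → ℕ} (hfg : ∀ᶠ n in atTop, f n ≤ g n) :
    ∀ᶠ n in atTop, n ∈ window 0 g → ∀ k, n ≤ k → k < f n → k ∉ upperSet g := by
  filter_upwards [hfg] with n hn ⟨j, h1, h2⟩ k hk hk'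
  exact notMem_upperSet (h1.trans hk)
    (hk'.trans_le (hn.trans (apply_lt_endpoint_succ g (j := 4 * j + 1) h2.le).le))

theorem window_two_gap {f g : ℕ → ℕ} (hfg : ∀ᶠ n in atTop, f n ≤ g n) :
    ∀ᶠ n in atTop, n ∈ window 2 g → ∀ k, n ≤ k → k < f n → k ∉ lowerSet g := by
  filter_upwards [hfg] with n hn ⟨j, h1, h2⟩ k hk hk'
  exact notMem_lowerSet (h1.trans hk)
    (hk'.trans_le (hn.trans (apply_lt_endpoint_succ g (j := 4 * j + 3) h2.le).le))

theorem disjoint_window_zero_upperSet (g : ℕ → ℕ) : Disjoint (window 0 g) (upperSet g) :=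
  Set.disjoint_left.2 fun _ ⟨_, h1, h2⟩ =>
    notMem_upperSet h1 (h2.trans (endpoint_strictMono g (by omega)))

theorem disjoint_window_two_lowerSet (g : ℕ → ℕ) : Disjoint (window 2 g) (lowerSet g) :=
  Set.disjoint_left.2 fun _ ⟨_, h1, h2⟩ =>
    notMem_lowerSet h1 (h2.trans (endpoint_strictMono g (by omega)))

theorem compl_union_infinite (g : ℕ → ℕ) : (upperSet g ∪ lowerSet g)ᶜ.Infinite := by
  refine (Set.infinite_range_of_injective (f := fun j => endpoint g (4 * j)) fun a b h => ?_).mono ?_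
  · have := (endpoint_strictMono g).injective h
    omega
  · rintro _ ⟨j, rfl⟩
    rw [Set.mem_compl_iff, Set.mem_union, not_or]
    exact ⟨notMem_upperSet le_rfl (endpoint_strictMono g (by omega)),
      endpoint_notMem_lowerSet g j⟩

theorem eq_endpoint_of_mem_iff {g : ℕ → ℕ} {k : ℕ} (h : k ∈ upperSet g ↔ k ∈ lowerSet g) :
    ∃ j, k = endpoint g (4 * j) := by
  obtain ⟨i, h1, h2⟩ := exists_endpoint_le_lt g k
  have hm := (endpoint_strictMono g).monotone
  obtain hi | hi : i % 4 < 2 ∨ 2 ≤ i % 4 := lt_or_ge _ _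
  · have h3 : endpoint g (4 * (i / 4)) ≤ k := (hm (by omega)).trans h1
    have h4 : k < endpoint g (4 * (i / 4) + 2) := h2.trans_le (hm (by omega))
    refine ⟨i / 4, by_contra fun hne => notMem_upperSet h3 h4 (h.2 ⟨i / 4, ?_, h4⟩)⟩
    omega
  · have h3 : endpoint g (4 * (i / 4) + 2) ≤ k := (hm (by omega)).trans h1
    have h4 : k < endpoint g (4 * (i / 4) + 4) := h2.trans_le (hm (by omega))
    exact absurd (h.1 ⟨i / 4, h3, h4⟩) (notMem_lowerSet h3 h4)

/-- The numbers at which two subsets of `ℕ` agree. -/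
def agreement (x y : Set ℕ) : Set ℕ := {i | i ∈ x ↔ i ∈ y}

theorem ncard_agreement_le {g h : ℕ → ℕ} (hh : Monotone h) (hg : ∀ n, h n ≤ g n) (n : ℕ) :
    (agreement (upperSet g) (lowerSet g) ∩ Set.Iio (h n)).ncard ≤ n + 1 := by
  have hsub : agreement (upperSet g) (lowerSet g) ∩ Set.Iio (h n) ⊆
      ((Finset.range (n + 1)).image fun j => endpoint g (4 * j) : Finset ℕ) := by
    rintro k ⟨hk, hk'⟩
    obtain ⟨j, rfl⟩ := eq_endpoint_of_mem_iff hk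
    simp only [Finset.coe_image, Finset.coe_range]
    refine ⟨j, ?_, rfl⟩
    by_contra hj
    simp only [Set.mem_Iio, not_lt] at hj hk'
    obtain ⟨i, hi⟩ : ∃ i, 4 * j = i + 1 := ⟨4 * j - 1, by omega⟩
    have h1 : i ≤ endpoint g i := (endpoint_strictMono g).le_apply
    have h2 := apply_lt_endpoint_succ g (le_refl (endpoint g i))
    have h3 := hg (endpoint g i)
    have h4 : h n ≤ h (endpoint g i) := hh (by omega)
    rw [hi] at hk'
    omega
  refine (Set.ncard_le_ncard hsub).trans ?_
  rw [Set.ncard_coe_finset]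
  exact Finset.card_image_le.trans (by simp)

/-- A function on `Set ℕ` depends only on the elements below `n`. -/
def DeterminedBelow (n : ℕ) (f : Set ℕ → Bool) : Prop := ∀ x, f x = f (x ∩ Set.Iio n)

theorem DeterminedBelow.mono {m n : ℕ} (h : m ≤ n) {f : Set ℕ → Bool}
    (hf : DeterminedBelow m f) : DeterminedBelow n f := fun x => by
  rw [hf x, hf (x ∩ Set.Iio n), Set.inter_assoc,
    Set.inter_eq_right.2 (Set.Iio_subset_Iio h)]

theorem finite_determinedBelow (n : ℕ) : {f | DeterminedBelow n f}.Finite := by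
  have : Finite (𝒫 (Set.Iio n)) := (Set.finite_Iio n).finite_subsets
  refine Set.Finite.of_finite_image (f := fun f (s : 𝒫 (Set.Iio n)) => f s) (Set.toFinite _) ?_
  intro f hf g hg hfg
  funext x
  rw [hf x, hg x]
  exact congrFun hfg ⟨_, Set.inter_subset_right⟩

/-- The functions `Set ℕ → Bool` depending on finitely many coordinates, with the topology of
pointwise convergence on `W`. -/
def EvalSpace (_W : Set (Set ℕ)) : Type := {f : Set ℕ → Bool // ∃ n, DeterminedBelow n f}

namespace EvalSpace

variable {W : Set (Set ℕ)}

/-- Restriction of a function to the points of `W`. -/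
def restrict (f : EvalSpace W) (x : W) : Bool := f.1 x

instance : TopologicalSpace (EvalSpace W) := TopologicalSpace.induced restrict inferInstance

instance : CompletelyRegularSpace (EvalSpace W) :=
  Topology.IsInducing.completelyRegularSpace (f := restrict) ⟨rfl⟩

theorem t2Space (hW : {x | x.Finite} ⊆ W) : T2Space (EvalSpace W) := by
  refine T2Space.of_injective_continuous (f := restrict) ?_ continuous_induced_dom
  rintro ⟨f, m, hf⟩ ⟨g, n, hg⟩ h
  refine Subtype.ext (funext fun x => ?_)
  change f x = g x
  rw [hf.mono (le_max_left m n) x, hg.mono (le_max_right m n) x]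
  exact congrFun h ⟨_, hW ((Set.finite_Iio _).subset Set.inter_subset_right)⟩

theorem continuous_eval {x : Set ℕ} (hx : x ∈ W) : Continuous fun f : EvalSpace W => f.1 x :=
  (continuous_apply (⟨x, hx⟩ : W)).comp (continuous_induced_dom (f := restrict))

theorem exists_finset_of_mem_open {U : Set (EvalSpace W)} (hU : IsOpen U) {f : EvalSpace W}
    (hf : f ∈ U) : ∃ Z : Finset (Set ℕ), ↑Z ⊆ W ∧
      ∀ g : EvalSpace W, (∀ z ∈ Z, g.1 z = f.1 z) → g ∈ U := by
  classical
  obtain ⟨V, hV, rfl⟩ := isOpen_induced_iff.1 hU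
  obtain ⟨I, u, hu, hI⟩ := isOpen_pi_iff.1 hV _ hf
  refine ⟨I.image Subtype.val, by simp, fun g hg => hI fun a ha => ?_⟩
  have : restrict g a = restrict f a := hg a (Finset.mem_image_of_mem _ ha)
  rw [this]
  exact (hu a ha).2

theorem exists_mem_of_dense {D : Set (EvalSpace W)} (hD : Dense D) (f : EvalSpace W)
    {Z : Set (Set ℕ)} (hZ : Z.Finite) (hZW : Z ⊆ W) : ∃ d ∈ D, ∀ z ∈ Z, d.1 z = f.1 z := by
  have hopen : IsOpen (⋂ z ∈ Z, {g : EvalSpace W | g.1 z = f.1 z}) :=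
    hZ.isOpen_biInter fun z hz =>
      (isOpen_discrete {f.1 z}).preimage (continuous_eval (hZW hz))
  obtain ⟨d, hd, hdD⟩ := hD.inter_open_nonempty _ hopen ⟨f, by simp⟩
  exact ⟨d, hdD, by simpa using hd⟩

theorem mSeparable {ι : Type} [LinearOrder ι]
    (hι : ∀ a : ι, Cardinal.mk (Set.Iio a) < boundingNumber) (z : ι → Set ℕ) (A : ι → Set ℕ)
    (hA : ∀ p : Finset ι, {n | ∀ a ∈ p, n ∈ A a}.Infinite)
    (hz : ∀ f : ℕ → ℕ, ∃ a₀, ∀ a, a₀ ≤ a →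
      ∀ᶠ n in atTop, n ∈ A a → ∀ k, n ≤ k → k < f n → k ∉ z a) :
    MSeparable (EvalSpace ({x | x.Finite} ∪ Set.range z)) := by
  intro D hD
  have hgood : ∀ (p : Finset ι) (n : ℕ), ∃ m, ∀ e : Set ℕ → Bool, DeterminedBelow n e →
      ∃ d ∈ D n, DeterminedBelow m d.1 ∧ (∀ b ∈ p, d.1 (z b) = e (z b)) ∧
        ∀ s, s ⊆ Set.Iio n → d.1 s = e s := by
    intro p n
    have h : ∀ e : {f | DeterminedBelow n f}, ∃ d ∈ D n,
        (∀ b ∈ p, d.1 (z b) = e.1 (z b)) ∧ ∀ s, s ⊆ Set.Iio n → d.1 s = e.1 s := by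
      rintro ⟨e, he⟩
      obtain ⟨d, hd, hde⟩ := exists_mem_of_dense (hD n) ⟨e, n, he⟩
        (Z := z '' p ∪ 𝒫 (Set.Iio n))
        ((p.finite_toSet.image z).union (Set.finite_Iio n).finite_subsets) (by
          rintro x (⟨b, -, rfl⟩ | hx)
          · exact Or.inr ⟨b, rfl⟩
          · exact Or.inl ((Set.finite_Iio n).subset hx))
      exact ⟨d, hd, fun b hb => hde _ (Or.inl ⟨b, hb, rfl⟩), fun s hs => hde _ (Or.inr hs)⟩
    choose d hd hdp hds using h
    choose l hl using fun e => (d e).2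
    have := (finite_determinedBelow n).to_subtype
    obtain ⟨m, hm⟩ := (Set.finite_range l).bddAbove
    exact ⟨m, fun e he => ⟨d ⟨e, he⟩, hd _, (hl _).mono (hm ⟨_, rfl⟩), hdp _, hds _⟩⟩
  choose G hG using hgood
  have hstep : ∀ a : ι, ∃ b, ∃ K : ℕ → ℕ, ∀ p : Finset ι, (∀ c ∈ p, c < a) →
      (∀ᶠ n in atTop, G p n ≤ K n) ∧ ∀ c, b ≤ c →
        ∀ᶠ n in atTop, n ∈ A c → ∀ k, n ≤ k → k < G p n → k ∉ z c := by
    intro a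
    obtain ⟨K, hK⟩ := exists_eventual_bound_finset_Iio (hι a) G
    obtain ⟨b, hb⟩ := hz K
    refine ⟨b, K, fun p hp => ⟨hK p hp, fun c hc => ?_⟩⟩
    filter_upwards [hK p hp, hb c hc] with n hn hn' hA k hk hk'
    exact hn' hA k hk (hk'.trans_le hn)
  choose β K hK using hstep
  obtain ⟨a₀, -⟩ := hz 0
  let α : ℕ → ι := fun n => (fun a => max a (β a))^[n] a₀
  have hα : ∀ n, α (n + 1) = max (α n) (β (α n)) := fun n =>
    Function.iterate_succ_apply' _ _ _
  have hmono : Monotone α := monotone_nat_of_le_succ fun n => by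
    rw [hα]
    exact le_max_left _ _
  obtain ⟨H, hH⟩ := exists_eventual_bound_of_nat fun n => K (α n)
  refine ⟨fun n => {d ∈ D n | DeterminedBelow (H n) d.1}, fun n => ⟨Set.sep_subset _ _, ?_⟩, ?_⟩
  · exact ((finite_determinedBelow (H n)).preimage Subtype.val_injective.injOn).subset
      fun d hd => hd.2
  rw [dense_iff_inter_open]
  rintro U hU ⟨e, heU⟩
  obtain ⟨Z, hZW, hZ⟩ := exists_finset_of_mem_open hU heU
  obtain ⟨m₀, he⟩ := e.2
  have hZ' : ∀ x : Z, ∃ N : ℕ, ∃ q : Finset ι, x.1 ⊆ Set.Iio N ∨ ∃ b ∈ q, z b = x.1 := by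
    rintro ⟨x, hx⟩
    rcases hZW hx with hx | ⟨b, hb⟩
    · obtain ⟨N, hN⟩ := Set.Finite.bddAbove hx
      exact ⟨N + 1, ∅, Or.inl fun k hk => Nat.lt_succ_of_le (hN hk)⟩
    · exact ⟨0, {b}, Or.inr ⟨b, Finset.mem_singleton_self b, hb⟩⟩
  classical
  choose N q hNq using hZ'
  obtain ⟨M, hM⟩ := (Set.finite_range N).bddAbove
  let Q : Finset ι := Finset.univ.biUnion q
  obtain ⟨n, hn⟩ : ∃ n, ∀ b ∈ Q, b < α (n + 1) → b < α n := by
    by_contra! hcon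
    choose b hbQ hb hb' using hcon
    have key : ∀ i j, i < j → b i ≠ b j := fun i j hij h =>
      absurd ((hb i).trans_le (hmono hij)) (by rw [h]; exact (hb' j).not_gt)
    obtain ⟨i, j, hij, h⟩ := Finite.exists_ne_map_eq_of_infinite fun n => (⟨b n, hbQ n⟩ : Q)
    rcases lt_or_gt_of_ne hij with hlt | hlt
    · exact key i j hlt (congrArg Subtype.val h)
    · exact key j i hlt (congrArg Subtype.val h).symm
  let p := Q.filter (· < α n)
  let r := Q.filter fun b => ¬ b < α n
  obtain ⟨hGK, hgap⟩ := hK (α n) p fun c hc => (Finset.mem_filter.1 hc).2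
  have hr : ∀ᶠ k in atTop, ∀ c ∈ r, k ∈ A c → ∀ l, k ≤ l → l < G p k → l ∉ z c := by
    refine (Finset.eventually_all r).2 fun c hc => hgap c ?_
    obtain ⟨hcQ, hc⟩ := Finset.mem_filter.1 hc
    have : α (n + 1) ≤ c := not_lt.1 fun h => hc (hn c hcQ h)
    rw [hα] at this
    exact (le_max_right _ _).trans this
  obtain ⟨k, hkA, ⟨⟨⟨hkr, hkK⟩, hkH⟩, hkm⟩, hkM⟩ :=
    ((Nat.frequently_atTop_iff_infinite.2 (hA r)).and_eventually
      ((((hr.and hGK).and (hH n)).and (eventually_ge_atTop m₀)).and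
        (eventually_ge_atTop M))).exists
  have hek := he.mono hkm
  obtain ⟨d, hdD, hdG, hdp, hds⟩ := hG p k e.1 hek
  refine ⟨d, hZ d fun x hx => ?_, Set.mem_iUnion.2 ⟨k, hdD, hdG.mono (hkK.trans hkH)⟩⟩
  rcases hNq ⟨x, hx⟩ with hxN | ⟨b, hb, rfl⟩
  · exact hds _ (hxN.trans (Set.Iio_subset_Iio ((hM ⟨_, rfl⟩).trans hkM)))
  · have hbQ : b ∈ Q := Finset.mem_biUnion.2 ⟨_, Finset.mem_univ _, hb⟩
    by_cases hbα : b < α n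
    · exact hdp b (Finset.mem_filter.2 ⟨hbQ, hbα⟩)
    · have hbr : b ∈ r := Finset.mem_filter.2 ⟨hbQ, hbα⟩
      have hzk : z b ∩ Set.Iio (max (G p k) k) = z b ∩ Set.Iio k := by
        ext l
        simp only [Set.mem_inter_iff, Set.mem_Iio, lt_max_iff]
        refine and_congr_right fun hl => or_iff_right_of_imp fun hlG => ?_
        exact not_le.1 fun hkl => hkr b hbr (hkA b hbr) l hkl hlG hl
      rw [hdG.mono (le_max_left _ k) (z b), hzk, hds _ Set.inter_subset_right, ← hek]

theorem not_mSeparable_prod {W₁ W₂ : Set (Set ℕ)}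
    (hinf : ∀ x ∈ W₁, ∀ y ∈ W₂, (agreement x y).Infinite)
    (hdom : ∀ h : ℕ → ℕ, ∃ x ∈ W₁, ∃ y ∈ W₂, ∀ n, (agreement x y ∩ Set.Iio (h n)).ncard ≤ n + 1) :
    ¬ MSeparable (EvalSpace W₁ × EvalSpace W₂) := by
  classical
  intro hsep
  obtain ⟨F, hF, hdense⟩ := hsep
    (fun n => {d | ∃ m, ∀ x y, d.1.1 x = true → d.2.1 y = true →
      n + 1 < (agreement x y ∩ Set.Iio m).ncard}) fun n => by
    rw [dense_iff_inter_open]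
    rintro U hU ⟨⟨e₁, e₂⟩, he⟩
    obtain ⟨U₁, U₂, hU₁, hU₂, he₁, he₂, hsub⟩ := isOpen_prod_iff.1 hU _ _ he
    obtain ⟨Z₁, hZ₁W, hZ₁⟩ := exists_finset_of_mem_open hU₁ he₁
    obtain ⟨Z₂, hZ₂W, hZ₂⟩ := exists_finset_of_mem_open hU₂ he₂
    obtain ⟨m₁, hm₁⟩ := e₁.2
    obtain ⟨m₂, hm₂⟩ := e₂.2
    have hcount : ∀ᶠ m in atTop, ∀ x ∈ Z₁, ∀ y ∈ Z₂,
        n + 1 < (agreement x y ∩ Set.Iio m).ncard := by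
      refine (Finset.eventually_all Z₁).2 fun x hx => (Finset.eventually_all Z₂).2 fun y hy => ?_
      obtain ⟨t, ht, htc⟩ := (hinf x (hZ₁W hx) y (hZ₂W hy)).exists_subset_card_eq (n + 2)
      obtain ⟨b, hb⟩ := t.bddAbove
      filter_upwards [eventually_gt_atTop b] with m hm
      have : (t : Set ℕ) ⊆ agreement x y ∩ Set.Iio m := fun k hk =>
        ⟨ht hk, (hb hk).trans_lt hm⟩
      have := Set.ncard_le_ncard this ((Set.finite_Iio m).subset Set.inter_subset_right)
      rw [Set.ncard_coe_finset] at this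
      omega
    obtain ⟨m, ⟨hm, hmm₁⟩, hmm₂⟩ := ((hcount.and (eventually_ge_atTop m₁)).and
      (eventually_ge_atTop m₂)).exists
    let cut : Finset (Set ℕ) → (Set ℕ → Bool) → Set ℕ → Bool := fun Z e x =>
      decide (e x = true ∧ ∃ z ∈ Z, x ∩ Set.Iio m = z ∩ Set.Iio m)
    have hcut : ∀ Z e, DeterminedBelow m e → DeterminedBelow m (cut Z e) := by
      intro Z e he x
      simp only [cut, ← he x, Set.inter_assoc, Set.inter_self]
    have hcut_eq : ∀ Z e, ∀ z ∈ Z, cut Z e z = e z := by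
      intro Z e z hz
      have : ∃ z' ∈ Z, z ∩ Set.Iio m = z' ∩ Set.Iio m := ⟨z, hz, rfl⟩
      simp [cut, this]
    refine ⟨(⟨cut Z₁ e₁.1, m, hcut _ _ (hm₁.mono hmm₁)⟩, ⟨cut Z₂ e₂.1, m, hcut _ _ (hm₂.mono hmm₂)⟩),
      hsub ⟨hZ₁ _ (hcut_eq _ _), hZ₂ _ (hcut_eq _ _)⟩, m, fun x y hx hy => ?_⟩
    obtain ⟨-, z, hz, hxz⟩ := of_decide_eq_true hx
    obtain ⟨-, w, hw, hyw⟩ := of_decide_eq_true hy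
    have : agreement x y ∩ Set.Iio m = agreement z w ∩ Set.Iio m := by
      ext i
      have h1 := Set.ext_iff.1 hxz i
      have h2 := Set.ext_iff.1 hyw i
      simp only [Set.mem_inter_iff, Set.mem_Iio] at h1 h2
      simp only [agreement, Set.mem_inter_iff, Set.mem_Iio, Set.mem_ofPred_eq]
      tauto
    rw [this]
    exact hm z hz w hw
  have hbound : ∀ n, ∃ m, ∀ d ∈ F n, ∀ x y, d.1.1 x = true → d.2.1 y = true →
      n + 1 < (agreement x y ∩ Set.Iio m).ncard := by
    intro n
    choose! l hl using fun d (hd : d ∈ F n) => (hF n).1 hd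
    obtain ⟨m, hm⟩ := ((hF n).2.image l).bddAbove
    refine ⟨m, fun d hd x y hx hy => (hl d hd x y hx hy).trans_le ?_⟩
    exact Set.ncard_le_ncard
      (Set.inter_subset_inter_right _ (Set.Iio_subset_Iio (hm ⟨d, hd, rfl⟩)))
      ((Set.finite_Iio m).subset Set.inter_subset_right)
  choose h hh using hbound
  obtain ⟨x, hx, y, hy, hxy⟩ := hdom h
  have hopen : IsOpen {d : EvalSpace W₁ × EvalSpace W₂ | d.1.1 x = true ∧ d.2.1 y = true} :=
    ((isOpen_discrete {true}).preimage ((continuous_eval hx).comp continuous_fst)).inter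
      ((isOpen_discrete {true}).preimage ((continuous_eval hy).comp continuous_snd))
  obtain ⟨d, ⟨hd₁, hd₂⟩, hd⟩ := hdense.inter_open_nonempty _ hopen
    ⟨(⟨fun _ => true, 0, fun _ => rfl⟩, ⟨fun _ => true, 0, fun _ => rfl⟩), rfl, rfl⟩
  obtain ⟨n, hn⟩ := Set.mem_iUnion.1 hd
  exact absurd (hxy n) (hh n d hn x y hd₁ hd₂).not_ge

end EvalSpace

theorem exists_dominating_of_mk_eq {ι : Type} (hι : Cardinal.mk ι = dominatingNumber)
    (hinf : Cardinal.aleph0 ≤ Cardinal.mk ι) :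
    ∃ d : ι → ℕ → ℕ, ∀ h : ℕ → ℕ, ∃ a, ∀ n, h n ≤ d a n := by
  have hne : {c : Cardinal | ∃ F : Set (ℕ → ℕ), Cardinal.mk F = c ∧
      ∀ h : ℕ → ℕ, ∃ g ∈ F, ∀ᶠ n in atTop, h n ≤ g n}.Nonempty :=
    ⟨_, Set.univ, rfl, fun h => ⟨h, trivial, by simp⟩⟩
  obtain ⟨F, hF, hdom⟩ := csInf_mem hne
  have hF' : Cardinal.mk F = Cardinal.mk ι := hF.trans hι.symm
  have hcard : Cardinal.mk ι = Cardinal.mk (F × ℕ) := by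
    rw [Cardinal.mk_prod, Cardinal.lift_id, Cardinal.lift_id, Cardinal.mk_nat, hF',
      Cardinal.mul_aleph0_eq hinf]
  obtain ⟨φ⟩ := Cardinal.eq.1 hcard
  refine ⟨fun a n => (φ a).1.1 n + (φ a).2, fun h => ?_⟩
  obtain ⟨g, hg, hhg⟩ := hdom h
  obtain ⟨N, hN⟩ := eventually_atTop.1 hhg
  refine ⟨φ.symm (⟨g, hg⟩, ∑ k ∈ Finset.range N, h k), fun n => ?_⟩
  simp only [Equiv.apply_symm_apply]
  rcases lt_or_ge n N with hn | hn
  · have := Finset.single_le_sum (f := h) (fun _ _ => Nat.zero_le _) (Finset.mem_range.2 hn)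
    exact this.trans (Nat.le_add_left _ _)
  · exact (hN n hn).trans (Nat.le_add_right _ _)

theorem window_iInter_infinite {ι : Type} [LinearOrder ι] {g : ι → ℕ → ℕ} {r : ℕ}
    (hg : ∀ (a : ι) (p : Finset ι), (∀ b ∈ p, b < a) →
      ∀ᶠ n in atTop, nextElement {k | ∀ b ∈ p, k ∈ window r (g b)} n ≤ g a n) (p : Finset ι) :
    {k | ∀ b ∈ p, k ∈ window r (g b)}.Infinite := by
  classical
  induction p using Finset.induction_on_max with
  | empty => simpa using Set.infinite_univ
  | insert a p hp ih =>
    refine (inter_window_infinite ih (hg a p hp) r).mono fun k hk => ?_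
    simpa using ⟨hk.2, hk.1⟩

/-- Every function is dominated by a member of the family, which grows so quickly that its sets
`window r` have the strong finite intersection property and both meet those of earlier members. -/
theorem exists_fast_family (h : boundingNumber = dominatingNumber) :
    ∃ (ι : Type) (_ : LinearOrder ι) (g : ι → ℕ → ℕ),
      (∀ a : ι, Cardinal.mk (Set.Iio a) < boundingNumber) ∧
      (∀ f : ℕ → ℕ, ∃ a, (∀ n, f n ≤ g a n) ∧ ∀ b, a ≤ b → ∀ᶠ n in atTop, f n ≤ g b n) ∧
      (∀ r, r = 0 ∨ r = 2 → ∀ p : Finset ι, {k | ∀ b ∈ p, k ∈ window r (g b)}.Infinite) ∧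
      ∀ a b, a ≠ b → (window 0 (g a) ∩ window 2 (g b)).Infinite := by
  have hcard : Cardinal.mk boundingNumber.ord.ToType = boundingNumber :=
    Cardinal.mk_ord_toType _
  have hsmall : ∀ a : boundingNumber.ord.ToType, Cardinal.mk (Set.Iio a) < boundingNumber :=
    fun a => (Cardinal.mk_Iio_lt a (by simp)).trans_eq hcard
  obtain ⟨d, hd⟩ := exists_dominating_of_mk_eq (hcard.trans h)
    (hcard.symm ▸ aleph0_lt_boundingNumber.le)
  obtain ⟨g, hg⟩ := exists_recursive_bound hsmall
    (fun p g n => nextElement {k | ∀ b ∈ p, k ∈ window 0 (g b)} n +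
      nextElement {k | ∀ b ∈ p, k ∈ window 2 (g b)} n + ∑ b ∈ p, d b n)
    (fun p g g' hgg => by
      have : ∀ r, {k | ∀ b ∈ p, k ∈ window r (g b)} = {k | ∀ b ∈ p, k ∈ window r (g' b)} :=
        fun r => Set.ext fun k => forall₂_congr fun b hb => by rw [hgg b hb]
      simp only [this]) d
  have hnext : ∀ r, r = 0 ∨ r = 2 → ∀ a (p : Finset _), (∀ b ∈ p, b < a) →
      ∀ᶠ n in atTop, nextElement {k | ∀ b ∈ p, k ∈ window r (g b)} n ≤ g a n := by
    rintro r hr a p hp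
    filter_upwards [(hg a).2 p hp] with n hn
    rcases hr with rfl | rfl <;> omega
  have hfip := fun r hr => window_iInter_infinite (hnext r hr)
  have hmeet : ∀ r s, r = 0 ∨ r = 2 → ∀ a b, a < b →
      (window r (g a) ∩ window s (g b)).Infinite := by
    intro r s hr a b hab
    have h1 := hfip r hr {a}
    have h2 := hnext r hr b {a} (by simpa using hab)
    simpa using inter_window_infinite h1 h2 s
  refine ⟨_, inferInstance, g, hsmall, fun f => ?_, hfip, fun a b hab => ?_⟩
  · obtain ⟨a, ha⟩ := hd f
    refine ⟨a, fun n => (ha n).trans ((hg a).1 n), fun b hab => ?_⟩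
    rcases hab.eq_or_lt with rfl | hab
    · exact Eventually.of_forall fun n => (ha n).trans ((hg a).1 n)
    · filter_upwards [(hg b).2 {a} (by simpa using hab)] with n hn
      have := ha n
      simp only [Finset.sum_singleton] at hn
      omega
  · rcases lt_or_gt_of_ne hab with hab | hab
    · exact hmeet 0 2 (Or.inl rfl) a b hab
    · rw [Set.inter_comm]
      exact hmeet 2 0 (Or.inr rfl) b a hab

theorem agreement_infinite_of_compl {x y : Set ℕ} (h : (xᶜ ∩ yᶜ).Infinite) :
    (agreement x y).Infinite :=
  h.mono fun _ hi => iff_of_false hi.1 hi.2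

/-- `𝔟 = 𝔡` implies that M-separability is not preserved by finite products: there are
completely regular Hausdorff M-separable spaces whose product is not M-separable. -/
theorem stmt_12 (h : boundingNumber = dominatingNumber) :
    ∃ (X : Type) (_ : TopologicalSpace X) (Y : Type) (_ : TopologicalSpace Y),
      CompletelyRegularSpace X ∧ T2Space X ∧
      CompletelyRegularSpace Y ∧ T2Space Y ∧
      MSeparable X ∧ MSeparable Y ∧ ¬ MSeparable (X × Y) := by
  obtain ⟨ι, _, g, hι, hdom, hfip, hmeet⟩ := exists_fast_family h
  have hx : ∀ a, (upperSet (g a))ᶜ.Infinite := fun a =>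
    (compl_union_infinite (g a)).mono (Set.compl_subset_compl.2 Set.subset_union_left)
  have hy : ∀ a, (lowerSet (g a))ᶜ.Infinite := fun a =>
    (compl_union_infinite (g a)).mono (Set.compl_subset_compl.2 Set.subset_union_right)
  refine ⟨EvalSpace ({x | x.Finite} ∪ Set.range fun a => upperSet (g a)), inferInstance,
    EvalSpace ({x | x.Finite} ∪ Set.range fun a => lowerSet (g a)), inferInstance,
    inferInstance, EvalSpace.t2Space Set.subset_union_left,
    inferInstance, EvalSpace.t2Space Set.subset_union_left,
    EvalSpace.mSeparable hι _ (fun a => window 0 (g a)) (hfip 0 (Or.inl rfl)) fun f => ?_,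
    EvalSpace.mSeparable hι _ (fun a => window 2 (g a)) (hfip 2 (Or.inr rfl)) fun f => ?_,
    EvalSpace.not_mSeparable_prod ?_ fun f => ?_⟩
  · obtain ⟨a, -, ha⟩ := hdom f
    exact ⟨a, fun b hb => window_zero_gap (ha b hb)⟩
  · obtain ⟨a, -, ha⟩ := hdom f
    exact ⟨a, fun b hb => window_two_gap (ha b hb)⟩
  · rintro x (hxf | ⟨a, rfl⟩) y (hyf | ⟨b, rfl⟩) <;> apply agreement_infinite_of_compl
    · exact hxf.infinite_compl.sdiff hyf
    · rw [Set.inter_comm]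
      exact (hy b).sdiff hxf
    · exact (hx a).sdiff hyf
    · rcases eq_or_ne a b with rfl | hab
      · rw [← Set.compl_union]
        exact compl_union_infinite _
      · exact (hmeet a b hab).mono (Set.inter_subset_inter
          (disjoint_window_zero_upperSet _).subset_compl_right
          (disjoint_window_two_lowerSet _).subset_compl_right)
  · obtain ⟨a, ha, -⟩ := hdom fun n => ∑ k ∈ Finset.range (n + 1), f k
    refine ⟨_, Or.inr ⟨a, rfl⟩, _, Or.inr ⟨a, rfl⟩, fun n => ?_⟩
    refine le_trans (Set.ncard_le_ncard (Set.inter_subset_inter_right _ (Set.Iio_subset_Iio ?_))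
      ((Set.finite_Iio _).subset Set.inter_subset_right)) (ncard_agreement_le (fun m n hmn => ?_) ha n)
    · exact Finset.single_le_sum (f := f) (fun _ _ => Nat.zero_le _) (Finset.self_mem_range_succ n)
    · exact Finset.sum_le_sum_of_subset (Finset.range_mono (by omega))
end

section
/- For every topological space X there exists a topological space Y such that the product X × Y is D-separable. -/
universe u

/-- `Z` is D-separable: for every sequence of dense sets one can select subsets, each
discrete in its subspace topology, whose union is dense. -/
def DSeparable (Z : Type*) [TopologicalSpace Z] : Prop :=
  ∀ D : ℕ → Set Z, (∀ n, Dense (D n)) →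
    ∃ F : ℕ → Set Z, (∀ n, F n ⊆ D n ∧ DiscreteTopology (F n)) ∧ Dense (⋃ n, F n)

/-- If `A` is discrete and its elements index all open sets of `X`, then `X × (ℕ → A)` is
D-separable. -/
theorem dSeparable_prod_nat_arrow {X A : Type*} [TopologicalSpace X] [TopologicalSpace A]
    [DiscreteTopology A] (f : A → Set X) (hf : ∀ U, IsOpen U → ∃ a, f a = U) :
    DSeparable (X × (ℕ → A)) := by
  intro D hD
  let r (n : ℕ) (y : ℕ → A) : Fin (n + 1) → A := fun i => y i
  have hr (n : ℕ) : Continuous (r n) := by fun_prop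
  let good (n : ℕ) (s : Fin (n + 1) → A) : Prop :=
    IsOpen (f (s (Fin.last n))) ∧ (f (s (Fin.last n))).Nonempty
  have pick (n : ℕ) (s : {s // good n s}) :
      ∃ z ∈ D n, z.1 ∈ f (s.1 (Fin.last n)) ∧ r n z.2 = s.1 := by
    obtain ⟨s, hs, x, hx⟩ := s
    have hopen : IsOpen (f (s (Fin.last n)) ×ˢ (r n ⁻¹' {s})) :=
      hs.prod ((isOpen_discrete _).preimage (hr n))
    have hne : (f (s (Fin.last n)) ×ˢ (r n ⁻¹' {s})).Nonempty := by
      refine ⟨(x, fun i => if h : i < n + 1 then s ⟨i, h⟩ else s (Fin.last n)), hx, ?_⟩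
      ext i
      simp only [r, i.isLt, dif_pos, Fin.eta]
    obtain ⟨z, hz, hzD⟩ := (hD n).inter_open_nonempty _ hopen hne
    exact ⟨z, hzD, hz.1, hz.2⟩
  choose p hpD hpf hpr using pick
  refine ⟨fun n => Set.range (p n), fun n => ⟨Set.range_subset_iff.2 (hpD n), ?_⟩, ?_⟩
  · refine DiscreteTopology.of_continuous_injective
      (f := fun z : Set.range (p n) => r n z.1.2) (by fun_prop) ?_
    rintro ⟨_, s, rfl⟩ ⟨_, t, rfl⟩ h
    have hst : s = t := Subtype.ext (by simpa only [hpr] using h)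
    subst hst
    rfl
  · rw [dense_iff_inter_open]
    rintro W hW ⟨⟨x, y⟩, hxy⟩
    obtain ⟨U, V, hU, hV, hxU, hyV, hUV⟩ := isOpen_prod_iff.1 hW x y hxy
    obtain ⟨_, ⟨z, n, rfl⟩, hyz, hzV⟩ :=
      (PiNat.isTopologicalBasis_cylinders (fun _ : ℕ => A)).exists_subset_of_mem_open hyV hV
    obtain ⟨a, ha⟩ := hf U hU
    let s : Fin (n + 1) → A := Fin.snoc (α := fun _ => A) (fun i : Fin n => y i) a
    have hs : good n s := by
      simp only [good, s, Fin.snoc_last, ha]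
      exact ⟨hU, x, hxU⟩
    refine ⟨p n ⟨s, hs⟩, hUV ⟨?_, hzV fun i hi => ?_⟩, Set.mem_iUnion.2 ⟨n, _, rfl⟩⟩
    · simpa [s, ha] using hpf n ⟨s, hs⟩
    · have h := congrFun (hpr n ⟨s, hs⟩) (Fin.castSucc ⟨i, hi⟩)
      simp only [r, s, Fin.snoc_castSucc, Fin.val_castSucc] at h
      exact h.trans (hyz i hi)

/-- Every topological space has a D-separable product with some nonempty space. -/
theorem exists_nonempty_dSeparable_prod (X : Type u) [TopologicalSpace X] :
    ∃ (Y : Type u) (_ : TopologicalSpace Y), Nonempty Y ∧ DSeparable (X × Y) := by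
  let _ : TopologicalSpace (Set X) := ⊥
  have : DiscreteTopology (Set X) := ⟨rfl⟩
  exact ⟨ℕ → Set X, inferInstance, inferInstance,
    dSeparable_prod_nat_arrow id fun U _ => ⟨U, rfl⟩⟩

/-- For every topological space `X` there is a topological space `Y` such that `X × Y`
is D-separable. -/
theorem stmt_14 (X : Type u) [TopologicalSpace X] :
    ∃ (Y : Type u) (_ : TopologicalSpace Y), DSeparable (X × Y) := by
  obtain ⟨Y, tY, -, hY⟩ := exists_nonempty_dSeparable_prod X
  exact ⟨Y, tY, hY⟩
end

section
/- Every maximal countable topological space is D-separable: if X is a countable topological space whose topology τ has no isolated points and is maximal among topologies on X without isolated points (i.e., every topology on X strictly finer than τ has an isolated point), then X is D-separable. -/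
open Set

section Maximal

variable {X : Type*} [τ : TopologicalSpace X]

/-- In a maximal crowded space, every subset without relatively isolated points is open. -/
theorem isOpen_of_crowded_of_maximal
    (hcrowded : ∀ x : X, ¬ IsOpen ({x} : Set X))
    (hmax : ∀ σ : TopologicalSpace X, σ < τ → ∃ x : X, σ.IsOpen {x})
    {A : Set X} (hA : ∀ V : Set X, IsOpen V → ∀ x, V ∩ A ≠ {x}) : IsOpen A := by
  by_contra hAo
  let σ : TopologicalSpace X :=
    { IsOpen := fun S => ∀ x ∈ S, ∃ V : Set X, τ.IsOpen V ∧ x ∈ V ∧ V ∩ A ⊆ S ∧ (x ∉ A → V ⊆ S)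
      isOpen_univ := fun x _ =>
        ⟨univ, τ.isOpen_univ, mem_univ x, subset_univ _, fun _ => subset_univ _⟩
      isOpen_inter := by
        rintro S T hS hT x ⟨hxS, hxT⟩
        obtain ⟨V, hV, hxV, hVS, hVS'⟩ := hS x hxS
        obtain ⟨W, hW, hxW, hWT, hWT'⟩ := hT x hxT
        exact ⟨V ∩ W, τ.isOpen_inter V W hV hW, ⟨hxV, hxW⟩,
          fun y hy => ⟨hVS ⟨hy.1.1, hy.2⟩, hWT ⟨hy.1.2, hy.2⟩⟩,
          fun hx => inter_subset_inter (hVS' hx) (hWT' hx)⟩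
      isOpen_sUnion := by
        rintro C hC x ⟨S, hS, hxS⟩
        obtain ⟨V, hV, hxV, hVS, hVS'⟩ := hC S hS x hxS
        exact ⟨V, hV, hxV, hVS.trans (subset_sUnion_of_mem hS),
          fun hx => (hVS' hx).trans (subset_sUnion_of_mem hS)⟩ }
  have hle : σ ≤ τ := fun S hS x hx => ⟨S, hS, hx, inter_subset_left, fun _ => Subset.rfl⟩
  have hσA : σ.IsOpen A := fun x hx =>
    ⟨univ, τ.isOpen_univ, mem_univ x, inter_subset_right, fun h => absurd hx h⟩
  have hne : σ ≠ τ := fun h => hAo (h ▸ hσA)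
  obtain ⟨x, hx⟩ := hmax σ (lt_of_le_of_ne hle hne)
  obtain ⟨V, hV, hxV, hVA, hVx⟩ := hx x rfl
  by_cases hxA : x ∈ A
  · exact hA V hV x (hVA.antisymm (singleton_subset_iff.2 ⟨hxV, hxA⟩))
  · exact hcrowded x ((hVx hxA).antisymm (singleton_subset_iff.2 hxV) ▸ hV)

/-- In a maximal crowded space, a point that is relatively isolated in a dense set belongs to
an open set with exactly two points. -/
theorem exists_isOpen_pair_of_dense_of_maximal
    (hcrowded : ∀ x : X, ¬ IsOpen ({x} : Set X))
    (hmax : ∀ σ : TopologicalSpace X, σ < τ → ∃ x : X, σ.IsOpen {x})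
    {D V : Set X} (hD : Dense D) (hV : IsOpen V) {x : X} (hx : V ∩ D = {x}) :
    ∃ y, IsOpen ({x, y} : Set X) := by
  have hxV : x ∈ V := (hx.symm ▸ mem_singleton x : x ∈ V ∩ D).1
  by_contra! hpair
  have hopen : IsOpen (V \ {x}) := by
    refine isOpen_of_crowded_of_maximal hcrowded hmax fun W hW y hy => ?_
    have hyW : y ∈ W ∩ (V \ {x}) := hy.symm ▸ mem_singleton y
    by_cases hxW : x ∈ W
    · refine hpair y ?_
      have : ({x, y} : Set X) = W ∩ V := by
        ext z
        have := Set.ext_iff.1 hy z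
        simp only [mem_inter_iff, mem_sdiff, mem_singleton_iff, mem_insert_iff] at *
        by_cases hz : z = x
        · subst hz; simp [hxW, hxV]
        · simp [hz, ← this]
      rw [this]
      exact hW.inter hV
    · refine hcrowded y ?_
      have : ({y} : Set X) = W ∩ V := by
        rw [← hy]
        ext z
        simp only [mem_inter_iff, mem_sdiff, mem_singleton_iff]
        exact ⟨fun h => ⟨h.1, h.2.1⟩, fun h => ⟨h.1, h.2, fun hz => hxW (hz ▸ h.1)⟩⟩
      rw [this]
      exact hW.inter hV
  rcases (V \ {x}).eq_empty_or_nonempty with he | hne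
  · exact hcrowded x (((sdiff_eq_empty.1 he).antisymm (singleton_subset_iff.2 hxV)) ▸ hV)
  · obtain ⟨z, ⟨hzV, hzx⟩, hzD⟩ := hD.inter_open_nonempty _ hopen hne
    exact hzx (hx ▸ (⟨hzV, hzD⟩ : z ∈ V ∩ D))

end Maximal

/-- A set is discrete as soon as each of its points has an open neighbourhood meeting the set
in that point only. -/
theorem discreteTopology_of_forall_exists_isOpen {X : Type*} [TopologicalSpace X] {S : Set X}
    (h : ∀ x ∈ S, ∃ U : Set X, IsOpen U ∧ x ∈ U ∧ ∀ y ∈ S, y ∈ U → y = x) :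
    DiscreteTopology S := by
  refine discreteTopology_iff_isOpen_singleton.2 fun ⟨x, hx⟩ => ?_
  obtain ⟨U, hU, hxU, hUS⟩ := h x hx
  refine ⟨U, hU, ?_⟩
  ext ⟨y, hy⟩
  simp only [mem_preimage, mem_singleton_iff, Subtype.mk.injEq]
  exact ⟨hUS y hy, fun h => h ▸ hxU⟩

/-- Every maximal countable space is D-separable: if `X` is countable, its topology has
no isolated points, and every strictly finer topology on `X` has an isolated point, then
`X` is D-separable. -/
theorem stmt_17
    {X : Type*} [Countable X] [τ : TopologicalSpace X]
    (hcrowded : ∀ x : X, ¬ IsOpen ({x} : Set X))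
    (hmax : ∀ σ : TopologicalSpace X, σ < τ → ∃ x : X, σ.IsOpen {x}) :
    DSeparable X := by
  intro D hD
  rcases isEmpty_or_nonempty X with hX | hX
  · exact ⟨fun _ => ∅, fun n => ⟨empty_subset _, inferInstance⟩, fun x => isEmptyElim x⟩
  obtain ⟨e, he⟩ := exists_surjective_nat X
  let P : Set X := {x | ∃ y, IsOpen ({x, y} : Set X)}
  let G : Set X := (closure P)ᶜ
  have hG : IsOpen G := isClosed_closure.isOpen_compl
  have hGP : ∀ x ∈ G, x ∉ P := fun x hx hxP => hx (subset_closure hxP)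
  have hPopen : IsOpen P := by
    refine isOpen_iff_forall_mem_open.2 fun x ⟨y, hy⟩ => ⟨{x, y}, ?_, hy, by simp⟩
    rintro z (rfl | rfl)
    · exact ⟨y, hy⟩
    · exact ⟨x, by rwa [pair_comm]⟩
  have hdense : ∀ E : Set X, Dense E → IsOpen (E ∩ G) := fun E hE =>
    isOpen_of_crowded_of_maximal hcrowded hmax fun V hV x hx => by
      have hxG : x ∈ G := (hx.symm ▸ mem_singleton x : x ∈ V ∩ (E ∩ G)).2.2
      refine hGP x hxG (exists_isOpen_pair_of_dense_of_maximal hcrowded hmax hE (hV.inter hG) ?_)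
      rw [← hx, inter_assoc, inter_comm G E]
  have hsel : ∀ n x, ∃ p, x ∈ P → p ∈ D n ∧ p ∈ P ∧ ∀ U : Set X, IsOpen U → x ∈ U → p ∈ U := by
    intro n x
    by_cases hx : x ∈ P
    · obtain ⟨y, hy⟩ := hx
      obtain ⟨p, hp, hpD⟩ := (hD n).inter_open_nonempty _ hy ⟨x, by simp⟩
      refine ⟨p, fun _ => ⟨hpD, ?_, fun U hU hxU => ?_⟩⟩
      · rcases hp with rfl | rfl
        · exact ⟨y, hy⟩
        · exact ⟨x, by rwa [pair_comm]⟩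
      · rcases hp with rfl | rfl
        · exact hxU
        · by_contra hpU
          refine hcrowded x ?_
          have : ({x} : Set X) = {x, p} ∩ U := by
            ext z
            simp only [mem_inter_iff, mem_insert_iff, mem_singleton_iff]
            constructor
            · rintro rfl; exact ⟨Or.inl rfl, hxU⟩
            · rintro ⟨rfl | rfl, h⟩
              · rfl
              · exact absurd h hpU
          rw [this]
          exact hy.inter hU
    · exact ⟨x, fun h => absurd h hx⟩
  choose p hp using hsel
  let O : ℕ → Set X := fun n => {x | x ∈ G ∧ ∀ i ≤ n, x ∈ D i}
  have hOopen : ∀ n, IsOpen (O n) := by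
    intro n
    have : O n = G ∩ ⋂ i ∈ Iic n, (D i ∩ G) := by
      ext x
      simp only [O, mem_ofPred_eq, mem_inter_iff, mem_iInter, mem_Iic]
      exact ⟨fun h => ⟨h.1, fun i hi => ⟨h.2 i hi, h.1⟩⟩, fun h => ⟨h.1, fun i hi => (h.2 i hi).1⟩⟩
    rw [this]
    exact hG.inter ((finite_Iic n).isOpen_biInter fun i _ => hdense _ (hD i))
  have hOdense : ∀ n (U : Set X), IsOpen U → (U ∩ G).Nonempty → (U ∩ O n).Nonempty := by
    intro n
    induction n with
    | zero =>
      intro U hU hne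
      obtain ⟨x, hx, hxD⟩ := (hD 0).inter_open_nonempty _ (hU.inter hG) hne
      exact ⟨x, hx.1, hx.2, fun i hi => by rwa [Nat.le_zero.1 hi]⟩
    | succ n ih =>
      intro U hU hne
      obtain ⟨x, hx, hxD⟩ :=
        (hD (n + 1)).inter_open_nonempty _ (hU.inter (hOopen n)) (ih U hU hne)
      refine ⟨x, hx.1, hx.2.1, fun i hi => ?_⟩
      rcases Nat.le_succ_iff.1 hi with h | rfl
      · exact hx.2.2 i h
      · exact hxD
  let S : ℕ → Set X := fun n => {x | x ∈ O n ∧ (x ∈ O (n + 1) → x = e n)}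
  have hScompl : ∀ n, Dense (S n)ᶜ := by
    intro n
    refine dense_iff_inter_open.2 fun U hU hne => ?_
    by_cases hUG : (U ∩ G).Nonempty
    · by_contra hcon
      obtain ⟨y, hyU, hyO⟩ := hOdense (n + 1) U hU hUG
      have hsub : ∀ z ∈ U ∩ O (n + 1), z = e n := fun z hz => by
        by_contra hze
        exact hcon ⟨z, hz.1, fun hzS => hze (hzS.2 hz.2)⟩
      refine hcrowded (e n) ?_
      have : ({e n} : Set X) = U ∩ O (n + 1) :=
        (singleton_subset_iff.2 (hsub y ⟨hyU, hyO⟩ ▸ ⟨hyU, hyO⟩)).antisymm hsub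
      rw [this]
      exact hU.inter (hOopen _)
    · obtain ⟨x, hx⟩ := hne
      exact ⟨x, hx, fun hxS => hUG ⟨x, hx, hxS.1.1⟩⟩
  refine ⟨fun n => S n ∪ {x | e n ∈ P ∧ x = p n (e n)},
    fun n => ⟨?_, ?_⟩, ?_⟩
  · rintro x (hx | ⟨hP, rfl⟩)
    · exact hx.1.2 n le_rfl
    · exact (hp n _ hP).1
  · refine discreteTopology_of_forall_exists_isOpen ?_
    rintro x (hx | ⟨hP, rfl⟩)
    · refine ⟨((S n)ᶜ ∪ {x}) ∩ G, hdense _ ((hScompl n).mono subset_union_left),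
        ⟨Or.inr rfl, hx.1.1⟩, ?_⟩
      rintro y (hy | ⟨hP, rfl⟩) ⟨hyS, hyG⟩
      · exact hyS.resolve_left fun h => h hy
      · exact absurd (hp n _ hP).2.1 (hGP _ hyG)
    · refine ⟨P, hPopen, (hp n _ hP).2.1, ?_⟩
      rintro y (hy | ⟨_, rfl⟩) hyP
      · exact absurd hyP (hGP _ hy.1.1)
      · rfl
  · refine dense_iff_inter_open.2 fun U hU hne => ?_
    by_cases hUG : (U ∩ G).Nonempty
    · obtain ⟨x, hxU, hxO⟩ := hOdense 0 U hU hUG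
      refine ⟨x, hxU, mem_iUnion.2 ?_⟩
      by_cases hall : ∀ m, x ∈ O m
      · obtain ⟨n, rfl⟩ := he x
        exact ⟨n, Or.inl ⟨hall n, fun _ => rfl⟩⟩
      · by_contra! hcon
        refine hall fun m => ?_
        induction m with
        | zero => exact hxO
        | succ m ih =>
          by_contra hm
          exact hcon m (Or.inl ⟨ih, fun h => absurd h hm⟩)
    · obtain ⟨x, hx⟩ := hne
      have hxP : x ∈ closure P := by
        by_contra h
        exact hUG ⟨x, hx, h⟩
      obtain ⟨z, hzU, hzP⟩ := mem_closure_iff.1 hxP U hU hx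
      obtain ⟨n, rfl⟩ := he z
      exact ⟨p n (e n), (hp n _ hzP).2.2 U hU hzU, mem_iUnion.2 ⟨n, Or.inr ⟨hzP, rfl⟩⟩⟩
end
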